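/- arXiv:1608.04896 — 2 statements merged into one kernel-verified Lean document; each statement's English description precedes it below -/
import Mathlib

section
/- Concavity and monotonicity in the coupling constant (Proposition 2.3): Let Ω ⊂ ℝ² be a nonempty bounded open set with smooth boundary, Ω^ext connected and H¹(∂Ω) > 0. Then the function α ↦ λ₁^α(Ω^ext) is strictly increasing and strictly concave on the interval (−∞, 0). -/
open MeasureTheory Metric Set Bornology Real Filter

noncomputable section

/-- The Euclidean plane. -/
abbrev E2 := EuclideanSpace ℝ (Fin 2)

/-- The exterior of a set: complement of its closure. -/
def extDom (Ω : Set E2) : Set E2 := (closure Ω)ᶜ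

/-- The lowest Robin eigenvalue of the exterior of `Ω`, defined variationally as the
infimum of Rayleigh quotients over smooth compactly supported test functions that are
not identically zero on the exterior. -/
def robinEig (α : ℝ) (Ω : Set E2) : ℝ :=
  sInf { q : ℝ | ∃ u : E2 → ℝ, ContDiff ℝ (⊤ : ℕ∞) u ∧ HasCompactSupport u ∧
    (∃ x ∈ extDom Ω, u x ≠ 0) ∧
    q = ((∫ x in extDom Ω, ‖fderiv ℝ u x‖ ^ 2) +
          α * ∫ x in frontier Ω, (u x) ^ 2 ∂(μH[1])) /
        (∫ x in extDom Ω, (u x) ^ 2) }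

/-- A planar set has smooth boundary if its topological boundary is the image of a
smooth, periodic, regular, injective (on one period) closed curve. -/
def HasSmoothBoundary (Ω : Set E2) : Prop :=
  ∃ γ : ℝ → E2, ContDiff ℝ (⊤ : ℕ∞) γ ∧ (∀ t, γ (t + 1) = γ t) ∧
    (∀ t, deriv γ t ≠ 0) ∧ InjOn γ (Ico 0 1) ∧ range γ = frontier Ω

/-- A pointwise bound for a function on an interval in terms of its `H¹` norm. -/
theorem sq_le_integral_sq_add_integral_deriv_sq {f f' : ℝ → ℝ}
    (hf : ∀ x, HasDerivAt f (f' x) x) (hf' : Continuous f') {r ε s : ℝ}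
    (hr : 0 < r) (hε : 0 < ε) (hs : s ∈ Icc 0 r) :
    f s ^ 2 ≤ (1 / r + 1 / ε) * (∫ x in (0 : ℝ)..r, f x ^ 2) +
      ε * ∫ x in (0 : ℝ)..r, f' x ^ 2 := by
  have hfc : Continuous f := continuous_iff_continuousAt.2 fun x => (hf x).continuousAt
  set k : ℝ → ℝ := fun x => 1 / ε * f x ^ 2 + ε * f' x ^ 2 with hk
  have hkc : Continuous k := by fun_prop
  have hk0 : ∀ x, 0 ≤ k x := fun x => by positivity
  have hbd : ∀ x, ‖2 * f x * f' x‖ ≤ k x := fun x => by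
    rw [Real.norm_eq_abs, abs_le, hk]
    have h1 : 0 ≤ (f x - ε * f' x) ^ 2 / ε := by positivity
    have h2 : 0 ≤ (f x + ε * f' x) ^ 2 / ε := by positivity
    have e1 : (f x - ε * f' x) ^ 2 / ε = 1 / ε * f x ^ 2 + ε * f' x ^ 2 - 2 * f x * f' x := by
      field_simp; ring
    have e2 : (f x + ε * f' x) ^ 2 / ε = 1 / ε * f x ^ 2 + ε * f' x ^ 2 + 2 * f x * f' x := by
      field_simp; ring
    constructor <;> simp only <;> linarith
  set K := ∫ x in (0 : ℝ)..r, k x with hK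
  have key : ∀ y ∈ Icc 0 r, f s ^ 2 - K ≤ f y ^ 2 := by
    intro y hy
    have h1 : ∫ x in y..s, 2 * f x * f' x = f s ^ 2 - f y ^ 2 := by
      rw [intervalIntegral.integral_eq_sub_of_hasDerivAt (f := fun x => f x ^ 2)]
      · intro x _
        have := (hf x).fun_pow 2
        simpa using this
      · exact (by fun_prop : Continuous fun x => 2 * f x * f' x).intervalIntegrable _ _
    have h2 : ‖∫ x in y..s, 2 * f x * f' x‖ ≤ ∫ x in Ioc 0 r, k x := by
      refine (intervalIntegral.norm_integral_le_integral_norm_uIoc).trans ?_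
      refine (integral_mono_of_nonneg (ae_of_all _ fun _ => norm_nonneg _)
        (hkc.integrableOn_uIoc) (ae_of_all _ hbd)).trans ?_
      refine setIntegral_mono_set (hkc.integrableOn_Ioc) (ae_of_all _ hk0) ?_
      refine (Ioc_subset_Ioc ?_ ?_).eventuallyLE
      · exact le_min hy.1 hs.1
      · exact max_le hy.2 hs.2
    rw [h1, ← intervalIntegral.integral_of_le hr.le, ← hK] at h2
    have := le_of_abs_le h2
    linarith
  have hgi : r * (f s ^ 2 - K) ≤ ∫ x in (0 : ℝ)..r, f x ^ 2 := by
    have := intervalIntegral.integral_mono_on (μ := volume) hr.le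
      (f := fun _ => f s ^ 2 - K) intervalIntegrable_const
      ((by fun_prop : Continuous fun x => f x ^ 2).intervalIntegrable _ _)
      key
    rwa [intervalIntegral.integral_const, sub_zero, smul_eq_mul] at this
  have hKe : K = 1 / ε * (∫ x in (0 : ℝ)..r, f x ^ 2) + ε * ∫ x in (0 : ℝ)..r, f' x ^ 2 := by
    rw [hK, hk, intervalIntegral.integral_add, intervalIntegral.integral_const_mul,
      intervalIntegral.integral_const_mul]
    · exact (by fun_prop : Continuous fun x => 1 / ε * f x ^ 2).intervalIntegrable _ _
    · exact (by fun_prop : Continuous fun x => ε * f' x ^ 2).intervalIntegrable _ _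
  have : f s ^ 2 - K ≤ 1 / r * ∫ x in (0 : ℝ)..r, f x ^ 2 := by
    rw [one_div, ← div_eq_inv_mul, le_div_iff₀ hr]
    linarith
  linarith

/-- The derivative of the smooth transition function is bounded and vanishes on `(-∞, 0]`. -/
theorem exists_abs_deriv_smoothTransition_le :
    ∃ D : ℝ, 0 ≤ D ∧ (∀ y, |deriv smoothTransition y| ≤ D) ∧
      ∀ y < 0, deriv smoothTransition y = 0 := by
  have hc : Continuous (deriv smoothTransition) :=
    (smoothTransition.contDiff (n := ⊤)).continuous_deriv (by simp)
  obtain ⟨D, hD⟩ := isCompact_Icc.exists_bound_of_continuousOn (s := Icc (0 : ℝ) 1) hc.continuousOn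
  have h0 : ∀ y < 0, deriv smoothTransition y = 0 := fun y hy => by
    have : smoothTransition =ᶠ[nhds y] fun _ => 0 := by
      filter_upwards [Iio_mem_nhds hy] with z hz using smoothTransition.zero_of_nonpos (le_of_lt hz)
    rw [this.deriv_eq, deriv_const]
  have h1 : ∀ y > 1, deriv smoothTransition y = 0 := fun y hy => by
    have : smoothTransition =ᶠ[nhds y] fun _ => 1 := by
      filter_upwards [Ioi_mem_nhds hy] with z hz using smoothTransition.one_of_one_le (le_of_lt hz)
    rw [this.deriv_eq, deriv_const]
  have hD0 : 0 ≤ D := (norm_nonneg _).trans (hD 0 (by simp))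
  refine ⟨D, hD0, fun y => ?_, h0⟩
  rcases lt_or_ge y 0 with h | h
  · simpa [h0 y h] using hD0
  rcases lt_or_ge 1 y with h' | h'
  · simpa [h1 y h'] using hD0
  · exact hD y ⟨h, h'⟩

theorem integral_radial_le (ρ : ℝ) (hρ : 0 ≤ ρ) :
    Integrable (fun x : E2 => (Iic ρ).indicator (fun y => 4 / (1 + y ^ 2)) ‖x‖) ∧
    ∫ x : E2, (Iic ρ).indicator (fun y => 4 / (1 + y ^ 2)) ‖x‖ =
      4 * volume.real (ball (0 : E2) 1) * log (1 + ρ ^ 2) := by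
  have hfun : ∀ y : ℝ, y ^ (Module.finrank ℝ E2 - 1) •
      (Iic ρ).indicator (fun y => 4 / (1 + y ^ 2)) y =
      (Iic ρ).indicator (fun y => 4 * y / (1 + y ^ 2)) y := by
    intro y
    by_cases hy : y ∈ Iic ρ
    · simp [indicator_of_mem hy, finrank_euclideanSpace]; ring
    · simp [indicator_of_notMem hy]
  have hset : Ioi (0 : ℝ) ∩ Iic ρ = Ioc 0 ρ := rfl
  have hcont : Continuous fun y : ℝ => 4 * y / (1 + y ^ 2) :=
    (by fun_prop : Continuous fun y : ℝ => 4 * y).div (by fun_prop) fun y => by positivity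
  constructor
  · rw [integrable_fun_norm_addHaar]
    simp only [hfun]
    rw [IntegrableOn, integrable_indicator_iff measurableSet_Iic, IntegrableOn,
      Measure.restrict_restrict measurableSet_Iic, inter_comm, hset]
    exact hcont.integrableOn_Ioc
  · rw [integral_fun_norm_addHaar]
    simp only [hfun]
    rw [setIntegral_indicator measurableSet_Iic, hset, ← intervalIntegral.integral_of_le hρ]
    rw [intervalIntegral.integral_eq_sub_of_hasDerivAt (f := fun y => 2 * log (1 + y ^ 2))]
    · simp [finrank_euclideanSpace]; ring
    · intro y _
      have h := (((hasDerivAt_pow 2 y).const_add 1).log (by positivity)).const_mul 2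
      refine h.congr_deriv ?_
      simp; ring
    · exact hcont.intervalIntegrable _ _

/-- Logarithmic cut-offs: in the plane the constant function `1` can be truncated outside any
ball at arbitrarily small cost in Dirichlet energy. -/
theorem exists_cutoff_dirichlet_lt (R : ℝ) {ε : ℝ} (hε : 0 < ε) :
    ∃ u : E2 → ℝ, ContDiff ℝ (⊤ : ℕ∞) u ∧ HasCompactSupport u ∧ (∀ x, ‖x‖ ≤ R → u x = 1) ∧
      ∫ x, ‖fderiv ℝ u x‖ ^ 2 < ε := by
  obtain ⟨D, hD0, hD, hDz⟩ := exists_abs_deriv_smoothTransition_le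
  set v := volume.real (ball (0 : E2) 1)
  have hv : 0 ≤ v := measureReal_nonneg
  obtain ⟨n, hn1, hnR, hnε⟩ : ∃ n : ℝ, 1 ≤ n ∧ log (1 + R ^ 2) ≤ n ∧ D ^ 2 * (12 * v) / n < ε := by
    refine ⟨max (max 1 (log (1 + R ^ 2))) (D ^ 2 * (12 * v) / ε + 1), ?_, ?_, ?_⟩
    · exact (le_max_left _ _).trans (le_max_left _ _)
    · exact (le_max_right _ _).trans (le_max_left _ _)
    · rw [div_lt_iff₀ (lt_of_lt_of_le zero_lt_one
        ((le_max_left _ _).trans (le_max_left _ _)))]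
      have : D ^ 2 * (12 * v) / ε < max (max 1 (log (1 + R ^ 2))) (D ^ 2 * (12 * v) / ε + 1) :=
        lt_of_lt_of_le (lt_add_one _) (le_max_right _ _)
      rw [div_lt_iff₀ hε] at this
      linarith
  have hn : 0 < n := by linarith
  set g : E2 → ℝ := fun x => 2 - log (1 + ‖x‖ ^ 2) / n with hg
  have hpos : ∀ x : E2, 0 < 1 + ‖x‖ ^ 2 := fun x => by positivity
  have hgs : ContDiff ℝ (⊤ : ℕ∞) g :=
    contDiff_const.sub (((contDiff_const.add (contDiff_norm_sq ℝ)).log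
      fun x => (hpos x).ne').div_const n)
  have hgd : ∀ x, HasFDerivAt g (-((n⁻¹ * (1 + ‖x‖ ^ 2)⁻¹ * 2) • innerSL ℝ x)) x := fun x => by
    have h := ((((hasStrictFDerivAt_norm_sq x).hasFDerivAt.const_add 1).log
      (hpos x).ne').mul_const n⁻¹).const_sub 2
    refine h.congr_fderiv ?_
    ext y
    simp
    ring
  have hneg : ∀ x : E2, exp n < ‖x‖ → g x < 0 := fun x hx => by
    have h1 : 2 * n < log (1 + ‖x‖ ^ 2) := by
      rw [Real.lt_log_iff_exp_lt (hpos x), two_mul, exp_add]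
      nlinarith [exp_pos n]
    have : 2 < log (1 + ‖x‖ ^ 2) / n := by rwa [lt_div_iff₀ hn]
    simp only [hg]; linarith
  refine ⟨fun x => smoothTransition (g x), smoothTransition.contDiff.comp hgs, ?_, ?_, ?_⟩
  · refine HasCompactSupport.intro (isCompact_closedBall (0 : E2) (exp n)) fun x hx => ?_
    exact smoothTransition.zero_of_nonpos (hneg x (by simpa using hx)).le
  · intro x hx
    refine smoothTransition.one_of_one_le ?_
    have h1 : log (1 + ‖x‖ ^ 2) ≤ log (1 + R ^ 2) :=
      log_le_log (hpos x) (by nlinarith [norm_nonneg x])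
    have : log (1 + ‖x‖ ^ 2) / n ≤ 1 := by rw [div_le_one hn]; linarith
    simp only [hg]; linarith
  · obtain ⟨hi, hie⟩ := integral_radial_le (exp n) (exp_pos n).le
    have hbound : ∀ x, ‖fderiv ℝ (fun x => smoothTransition (g x)) x‖ ^ 2 ≤
        (D / n) ^ 2 * (Iic (exp n)).indicator (fun y => 4 / (1 + y ^ 2)) ‖x‖ := fun x => by
      have hst : HasDerivAt smoothTransition (deriv smoothTransition (g x)) (g x) :=
        ((smoothTransition.contDiff (n := 1)).differentiable (by simp) _).hasDerivAt
      rw [HasFDerivAt.fderiv (f := fun x => smoothTransition (g x))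
        (hst.comp_hasFDerivAt x (hgd x))]
      by_cases hx : ‖x‖ ∈ Iic (exp n)
      · rw [indicator_of_mem hx, norm_smul, norm_neg, norm_smul, innerSL_apply_norm,
          Real.norm_eq_abs, Real.norm_eq_abs, abs_of_pos (a := n⁻¹ * _ * 2)
            (by have := hpos x; positivity)]
        have h1 : |deriv smoothTransition (g x)| ^ 2 ≤ D ^ 2 :=
          pow_le_pow_left₀ (abs_nonneg _) (hD _) 2
        have h2 : (n⁻¹ * (1 + ‖x‖ ^ 2)⁻¹ * 2 * ‖x‖) ^ 2 ≤ (1 / n) ^ 2 * (4 / (1 + ‖x‖ ^ 2)) := by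
          have e : (n⁻¹ * (1 + ‖x‖ ^ 2)⁻¹ * 2 * ‖x‖) ^ 2 =
            (1 / n) ^ 2 * (4 / (1 + ‖x‖ ^ 2)) * (‖x‖ ^ 2 / (1 + ‖x‖ ^ 2)) := by
            have := (hpos x).ne'
            field_simp; ring
          rw [e]
          refine mul_le_of_le_one_right (by positivity) ?_
          rw [div_le_one (hpos x)]; linarith
        rw [mul_pow]
        calc _ ≤ D ^ 2 * ((1 / n) ^ 2 * (4 / (1 + ‖x‖ ^ 2))) := by gcongr
          _ = _ := by ring
      · rw [indicator_of_notMem hx, hDz _ (hneg x (by simpa using hx))]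
        simp
    refine lt_of_le_of_lt (integral_mono_of_nonneg (ae_of_all _ fun _ => by positivity)
      (hi.const_mul _) (ae_of_all _ hbound)) ?_
    rw [integral_const_mul, hie]
    have hlog : log (1 + exp n ^ 2) ≤ 3 * n := by
      rw [Real.log_le_iff_le_exp (by positivity)]
      have e3 : exp (3 * n) = exp n ^ 2 * exp n := by rw [← exp_nat_mul, ← exp_add]; ring_nf
      have h2 : 2 ≤ exp n := by linarith [add_one_le_exp n]
      rw [e3]
      nlinarith [exp_pos n]
    refine lt_of_le_of_lt ?_ hnε
    calc (D / n) ^ 2 * (4 * v * log (1 + exp n ^ 2)) ≤ (D / n) ^ 2 * (4 * v * (3 * n)) := by gcongr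
      _ = D ^ 2 * (12 * v) / n := by field_simp; ring

/-- The Dirichlet energy of a function on the exterior domain. -/
def dirichletEnergy (Ω : Set E2) (u : E2 → ℝ) : ℝ := ∫ x in extDom Ω, ‖fderiv ℝ u x‖ ^ 2

/-- The squared `L²` norm of a function on the boundary. -/
def boundaryMass (Ω : Set E2) (u : E2 → ℝ) : ℝ := ∫ x in frontier Ω, (u x) ^ 2 ∂(μH[1])

/-- The squared `L²` norm of a function on the exterior domain. -/
def exteriorMass (Ω : Set E2) (u : E2 → ℝ) : ℝ := ∫ x in extDom Ω, (u x) ^ 2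

/-- Smooth functions with compact support in the plane. -/
structure IsTestFun (u : E2 → ℝ) : Prop where
  contDiff : ContDiff ℝ (⊤ : ℕ∞) u
  hasCompactSupport : HasCompactSupport u

namespace IsTestFun

variable {u v φ : E2 → ℝ}

theorem continuous (hu : IsTestFun u) : Continuous u := hu.contDiff.continuous

theorem differentiable (hu : IsTestFun u) : Differentiable ℝ u :=
  hu.contDiff.differentiable (by simp)

theorem continuous_fderiv (hu : IsTestFun u) : Continuous (fderiv ℝ u) :=
  hu.contDiff.continuous_fderiv (by simp)

theorem mul_left (hu : IsTestFun u) (hφ : ContDiff ℝ (⊤ : ℕ∞) φ) :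
    IsTestFun fun x => φ x * u x :=
  ⟨hφ.mul hu.contDiff, hu.hasCompactSupport.mul_left⟩

theorem integrable_mul_sq (hu : IsTestFun u) (hφ : Continuous φ) :
    Integrable fun x => φ x * u x ^ 2 := by
  have hc := hu.continuous
  refine Continuous.integrable_of_hasCompactSupport (by fun_prop) ?_
  exact (hu.hasCompactSupport.comp_left (g := fun t : ℝ => t ^ 2) (by simp)).mul_left

theorem integrable_sq (hu : IsTestFun u) : Integrable fun x => u x ^ 2 := by
  simpa using hu.integrable_mul_sq (φ := fun _ => 1) continuous_const

theorem integrable_fderiv_sq (hu : IsTestFun u) : Integrable fun x => ‖fderiv ℝ u x‖ ^ 2 := by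
  refine Continuous.integrable_of_hasCompactSupport (hu.continuous_fderiv.norm.pow 2) ?_
  exact (hu.hasCompactSupport.fderiv ℝ).norm.comp_left (g := fun x : ℝ => x ^ 2) (by simp)

end IsTestFun

theorem isOpen_extDom (Ω : Set E2) : IsOpen (extDom Ω) := isClosed_closure.isOpen_compl

theorem dirichletEnergy_nonneg (Ω : Set E2) (u : E2 → ℝ) : 0 ≤ dirichletEnergy Ω u :=
  integral_nonneg fun _ => by positivity

theorem exteriorMass_nonneg (Ω : Set E2) (u : E2 → ℝ) : 0 ≤ exteriorMass Ω u :=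
  integral_nonneg fun _ => by positivity

theorem exteriorMass_pos {Ω : Set E2} {u : E2 → ℝ} (hu : IsTestFun u)
    (h : ∃ x ∈ extDom Ω, u x ≠ 0) : 0 < exteriorMass Ω u := by
  obtain ⟨x, hx, hux⟩ := h
  have hc := hu.continuous
  rw [exteriorMass, setIntegral_pos_iff_support_of_nonneg_ae (ae_of_all _ fun _ => by positivity)
    hu.integrable_sq.integrableOn]
  have ho : IsOpen (Function.support (fun x => u x ^ 2) ∩ extDom Ω) :=
    (by fun_prop : Continuous fun x => u x ^ 2).isOpen_support.inter (isOpen_extDom Ω)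
  exact ho.measure_pos _ ⟨x, by simpa using hux, hx⟩

theorem robinEig_eq (α : ℝ) (Ω : Set E2) : robinEig α Ω = sInf { q : ℝ | ∃ u : E2 → ℝ,
    IsTestFun u ∧ (∃ x ∈ extDom Ω, u x ≠ 0) ∧
    q = (dirichletEnergy Ω u + α * boundaryMass Ω u) / exteriorMass Ω u } := by
  rw [robinEig]
  congr 1
  ext q
  constructor
  · rintro ⟨u, h1, h2, h3, h4⟩
    exact ⟨u, ⟨h1, h2⟩, h3, h4⟩
  · rintro ⟨u, h1, h3, h4⟩
    exact ⟨u, h1.1, h1.2, h3, h4⟩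

/-- The trace inequality with arbitrarily small constant in front of the energy. -/
def TraceEstimate (Ω : Set E2) : Prop :=
  ∀ ε > 0, ∃ C : ℝ, ∀ u, IsTestFun u →
    boundaryMass Ω u ≤ ε * dirichletEnergy Ω u + C * exteriorMass Ω u

/-- Functions of bounded energy do not concentrate at the boundary. -/
def NonConcentration (Ω : Set E2) : Prop :=
  ∀ η > 0, ∃ φ : E2 → ℝ, ∃ K : ℝ, ContDiff ℝ (⊤ : ℕ∞) φ ∧ (∀ x, φ x ∈ Icc 0 1) ∧
    (∀ x, ‖fderiv ℝ φ x‖ ≤ K) ∧ (∀ x ∈ frontier Ω, φ x = 0) ∧ ∀ u, IsTestFun u →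
    exteriorMass Ω u ≤ (∫ x in extDom Ω, φ x * u x ^ 2) +
      η * (dirichletEnergy Ω u + exteriorMass Ω u)

/-- For negative coupling the quadratic form takes negative values. -/
def HasNegativeForm (Ω : Set E2) : Prop :=
  ∀ α < 0, ∃ u, IsTestFun u ∧ (∃ x ∈ extDom Ω, u x ≠ 0) ∧
    dirichletEnergy Ω u + α * boundaryMass Ω u < 0

section Abstract

variable {Ω : Set E2} {α : ℝ} {u : E2 → ℝ}

theorem robinEig_mul_le (hT : TraceEstimate Ω) (hα : α < 0) (hu : IsTestFun u)
    (h : ∃ x ∈ extDom Ω, u x ≠ 0) :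
    robinEig α Ω * exteriorMass Ω u ≤ dirichletEnergy Ω u + α * boundaryMass Ω u := by
  rw [← le_div_iff₀ (exteriorMass_pos hu h), robinEig_eq]
  refine csInf_le ?_ ⟨u, hu, h, rfl⟩
  obtain ⟨C, hC⟩ := hT (-α)⁻¹ (by simpa using hα)
  refine ⟨α * C, ?_⟩
  rintro q ⟨v, hv, hv0, rfl⟩
  rw [le_div_iff₀ (exteriorMass_pos hv hv0)]
  have h1 := mul_le_mul_of_nonneg_left (hC v hv) (neg_pos.2 hα).le
  rw [mul_add, mul_inv_cancel_left₀ (neg_pos.2 hα).ne'] at h1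
  linarith

theorem exists_lt_of_robinEig_lt (hN : HasNegativeForm Ω) (hα : α < 0) {c : ℝ}
    (hc : robinEig α Ω < c) : ∃ u, IsTestFun u ∧ (∃ x ∈ extDom Ω, u x ≠ 0) ∧
      dirichletEnergy Ω u + α * boundaryMass Ω u < c * exteriorMass Ω u := by
  rw [robinEig_eq] at hc
  obtain ⟨v, hv, hv0, -⟩ := hN α hα
  obtain ⟨q, ⟨u, hu, hu0, rfl⟩, hq⟩ := exists_lt_of_csInf_lt (by exact ⟨_, v, hv, hv0, rfl⟩) hc
  exact ⟨u, hu, hu0, (div_lt_iff₀ (exteriorMass_pos hu hu0)).1 hq⟩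

theorem robinEig_neg (hT : TraceEstimate Ω) (hN : HasNegativeForm Ω) (hα : α < 0) :
    robinEig α Ω < 0 := by
  obtain ⟨u, hu, hu0, h⟩ := hN α hα
  have := robinEig_mul_le hT hα hu hu0
  have := exteriorMass_pos hu hu0
  by_contra! h'
  nlinarith

theorem robinEig_strictMonoOn (hT : TraceEstimate Ω) (hN : HasNegativeForm Ω) :
    StrictMonoOn (fun α => robinEig α Ω) (Iio 0) := by
  intro α hα β hβ hlt
  simp only [mem_Iio] at hα hβ
  have hneg := robinEig_neg hT hN hα
  have ht : β / α < 1 := by rw [div_lt_one_of_neg hα]; exact hlt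
  have ht0 : 0 < β / α := div_pos_of_neg_of_neg hβ hα
  obtain ⟨v, hv, hv0, -⟩ := hN β hβ
  have hle : β / α * robinEig α Ω ≤ robinEig β Ω := by
    rw [robinEig_eq β]
    refine le_csInf ⟨_, v, hv, hv0, rfl⟩ ?_
    rintro q ⟨u, hu, hu0, rfl⟩
    rw [le_div_iff₀ (exteriorMass_pos hu hu0)]
    have h1 := mul_le_mul_of_nonneg_left (robinEig_mul_le hT hα hu hu0) ht0.le
    have h2 : β / α * (dirichletEnergy Ω u + α * boundaryMass Ω u) =
        β / α * dirichletEnergy Ω u + β * boundaryMass Ω u := by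
      rw [mul_add, ← mul_assoc (β / α), div_mul_cancel₀ β hα.ne]
    have h3 := mul_le_of_le_one_left (dirichletEnergy_nonneg Ω u) ht.le
    linarith
  simp only
  nlinarith

theorem norm_add_sq_add_norm_sub_sq (a b : E2 →L[ℝ] ℝ) :
    ‖a + b‖ ^ 2 + ‖a - b‖ ^ 2 = 2 * (‖a‖ ^ 2 + ‖b‖ ^ 2) := by
  set e := (InnerProductSpace.toDual ℝ E2).symm
  have := parallelogram_law_with_norm ℝ (e a) (e b)
  rw [← map_add, ← map_sub] at this
  simp only [LinearIsometryEquiv.norm_map] at this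
  linarith

theorem dirichletEnergy_perturb {φ : E2 → ℝ} (hu : IsTestFun u) (hφ : ContDiff ℝ (⊤ : ℕ∞) φ)
    (τ : ℝ) : dirichletEnergy Ω (fun x => (1 + τ * φ x) * u x) +
      dirichletEnergy Ω (fun x => (1 - τ * φ x) * u x) =
      2 * (dirichletEnergy Ω u + τ ^ 2 * dirichletEnergy Ω fun x => φ x * u x) := by
  have hv := hu.mul_left hφ
  have h1 := hu.mul_left (φ := fun x => 1 + τ * φ x) (by fun_prop)
  have h2 := hu.mul_left (φ := fun x => 1 - τ * φ x) (by fun_prop)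
  simp only [dirichletEnergy]
  rw [← integral_add h1.integrable_fderiv_sq.restrict h2.integrable_fderiv_sq.restrict,
    ← integral_const_mul (τ ^ 2), ← integral_add hu.integrable_fderiv_sq.restrict
      (hv.integrable_fderiv_sq.restrict.const_mul _), ← integral_const_mul]
  congr 1 with x
  have e1 : fderiv ℝ (fun x => (1 + τ * φ x) * u x) x =
      fderiv ℝ u x + τ • fderiv ℝ (fun x => φ x * u x) x := by
    rw [← fderiv_const_mul (hv.differentiable x), ← fderiv_fun_add (hu.differentiable x)
      ((hv.differentiable x).const_mul _)]
    congr 1 with x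
    ring
  have e2 : fderiv ℝ (fun x => (1 - τ * φ x) * u x) x =
      fderiv ℝ u x - τ • fderiv ℝ (fun x => φ x * u x) x := by
    rw [← fderiv_const_mul (hv.differentiable x), ← fderiv_fun_sub (hu.differentiable x)
      ((hv.differentiable x).const_mul _)]
    congr 1 with x
    ring
  rw [e1, e2, norm_add_sq_add_norm_sub_sq, norm_smul, mul_pow, Real.norm_eq_abs, sq_abs]

theorem exteriorMass_perturb {φ : E2 → ℝ} (hu : IsTestFun u) (hφ : ContDiff ℝ (⊤ : ℕ∞) φ)
    (τ : ℝ) : exteriorMass Ω (fun x => (1 + τ * φ x) * u x) = exteriorMass Ω u +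
      2 * τ * (∫ x in extDom Ω, φ x * u x ^ 2) + τ ^ 2 * exteriorMass Ω fun x => φ x * u x := by
  have hi := (hu.integrable_mul_sq hφ.continuous).restrict (s := extDom Ω)
  have hv := (hu.mul_left hφ).integrable_sq.restrict (s := extDom Ω)
  have hu' := hu.integrable_sq.restrict (s := extDom Ω)
  simp only [exteriorMass]
  rw [← integral_const_mul, ← integral_const_mul, ← integral_add hu' (hi.const_mul _),
    ← integral_add (by exact hu'.add (hi.const_mul _)) (hv.const_mul _)]
  congr 1 with x
  ring

theorem exteriorMass_mul_le {φ : E2 → ℝ} (hu : IsTestFun u) (hφ : ContDiff ℝ (⊤ : ℕ∞) φ)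
    (h01 : ∀ x, φ x ∈ Icc 0 1) : exteriorMass Ω (fun x => φ x * u x) ≤ exteriorMass Ω u := by
  refine integral_mono (hu.mul_left hφ).integrable_sq.restrict hu.integrable_sq.restrict fun x => ?_
  simp only [mul_pow]
  exact mul_le_of_le_one_left (by positivity) (pow_le_one₀ (h01 x).1 (h01 x).2)

theorem dirichletEnergy_mul_le {φ : E2 → ℝ} {K : ℝ} (hu : IsTestFun u)
    (hφ : ContDiff ℝ (⊤ : ℕ∞) φ) (h01 : ∀ x, φ x ∈ Icc 0 1) (hK : ∀ x, ‖fderiv ℝ φ x‖ ≤ K) :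
    dirichletEnergy Ω (fun x => φ x * u x) ≤
      2 * dirichletEnergy Ω u + 2 * K ^ 2 * exteriorMass Ω u := by
  have hi := (hu.integrable_fderiv_sq.restrict (s := extDom Ω)).const_mul 2
  have hi' := (hu.integrable_sq.restrict (s := extDom Ω)).const_mul (2 * K ^ 2)
  simp only [exteriorMass, dirichletEnergy]
  rw [← integral_const_mul, ← integral_const_mul, ← integral_add hi hi']
  refine integral_mono (hu.mul_left hφ).integrable_fderiv_sq.restrict (hi.add hi') fun x => ?_
  have hφd : DifferentiableAt ℝ φ x := hφ.differentiable (by simp) x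
  simp only
  rw [fderiv_fun_mul hφd (hu.differentiable x)]
  have h1 : ‖φ x • fderiv ℝ u x + u x • fderiv ℝ φ x‖ ≤ ‖fderiv ℝ u x‖ + |u x| * K := by
    refine (norm_add_le _ _).trans (add_le_add ?_ ?_)
    · rw [norm_smul, Real.norm_eq_abs, abs_of_nonneg (h01 x).1]
      exact mul_le_of_le_one_left (norm_nonneg _) (h01 x).2
    · rw [norm_smul, Real.norm_eq_abs]
      exact mul_le_mul_of_nonneg_left (hK x) (abs_nonneg _)
  have h2 := pow_le_pow_left₀ (norm_nonneg _) h1 2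
  have h3 : (|u x| * K) ^ 2 = K ^ 2 * u x ^ 2 := by rw [mul_pow, sq_abs]; ring
  nlinarith [sq_nonneg (‖fderiv ℝ u x‖ - |u x| * K)]

/-- Testing the quadratic forms with `(1 ± τ φ) u`, where `φ` vanishes on the boundary. -/
theorem robinEig_perturb_le (hT : TraceEstimate Ω) {α β : ℝ} (hα : α < 0) (hβ : β < 0)
    {φ : E2 → ℝ} {K : ℝ} (hu : IsTestFun u) (hu0 : ∃ x ∈ extDom Ω, u x ≠ 0)
    (hφ : ContDiff ℝ (⊤ : ℕ∞) φ) (h01 : ∀ x, φ x ∈ Icc 0 1) (hK : ∀ x, ‖fderiv ℝ φ x‖ ≤ K)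
    (hφ0 : ∀ x ∈ frontier Ω, φ x = 0) {τ : ℝ} (hτ : |τ| ≤ 1 / 2) :
    2 * τ * (robinEig α Ω - robinEig β Ω) * (∫ x in extDom Ω, φ x * u x ^ 2) ≤
      (dirichletEnergy Ω u + α * boundaryMass Ω u - robinEig α Ω * exteriorMass Ω u) +
      (dirichletEnergy Ω u + β * boundaryMass Ω u - robinEig β Ω * exteriorMass Ω u) +
      τ ^ 2 * (4 * dirichletEnergy Ω u +
        (4 * K ^ 2 + |robinEig α Ω| + |robinEig β Ω|) * exteriorMass Ω u) := by
  have hpos : ∀ σ : ℝ, |σ| ≤ 1 / 2 → ∀ x, 1 + σ * φ x ≠ 0 := fun σ hσ x => by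
    have h1 : |σ * φ x| ≤ 1 / 2 := by
      rw [abs_mul, abs_of_nonneg (h01 x).1]
      exact (mul_le_of_le_one_right (abs_nonneg _) (h01 x).2).trans hσ
    have := (abs_le.1 h1).1
    linarith
  have hb : ∀ σ : ℝ, boundaryMass Ω (fun x => (1 + σ * φ x) * u x) = boundaryMass Ω u := by
    intro σ
    refine setIntegral_congr_fun isClosed_frontier.measurableSet fun x hx => ?_
    simp [hφ0 x hx]
  have hform : ∀ σ : ℝ, |σ| ≤ 1 / 2 → ∀ a < 0,
      robinEig a Ω * exteriorMass Ω (fun x => (1 + σ * φ x) * u x) ≤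
      dirichletEnergy Ω (fun x => (1 + σ * φ x) * u x) + a * boundaryMass Ω u := by
    intro σ hσ a ha
    rw [← hb σ]
    refine robinEig_mul_le hT ha (hu.mul_left (by fun_prop)) ?_
    obtain ⟨x, hx, hux⟩ := hu0
    exact ⟨x, hx, mul_ne_zero (hpos σ hσ x) hux⟩
  have h1 := hform τ hτ α hα
  have h2 := hform (-τ) (by rwa [abs_neg]) β hβ
  have h3 := dirichletEnergy_perturb (Ω := Ω) hu hφ τ
  rw [exteriorMass_perturb hu hφ] at h1 h2
  have e : (fun x => (1 - τ * φ x) * u x) = fun x => (1 + -τ * φ x) * u x := by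
    ext x; ring
  rw [e] at h3
  have h4 := dirichletEnergy_mul_le (Ω := Ω) hu hφ h01 hK
  have h5 := exteriorMass_mul_le (Ω := Ω) hu hφ h01
  have h6 := exteriorMass_nonneg Ω (fun x => φ x * u x)
  set P := ∫ x in extDom Ω, φ x * u x ^ 2
  set M := exteriorMass Ω (fun x => φ x * u x)
  set N := exteriorMass Ω u
  have hl : ∀ l : ℝ, -l * M ≤ |l| * N := fun l =>
    (mul_le_mul_of_nonneg_right (neg_le_abs l) h6).trans
      (mul_le_mul_of_nonneg_left h5 (abs_nonneg _))
  have h7 := mul_le_mul_of_nonneg_left (add_le_add (add_le_add h4 h4)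
    (add_le_add (hl (robinEig α Ω)) (hl (robinEig β Ω)))) (sq_nonneg τ)
  linarith

theorem robinEig_strictConcaveOn (hT : TraceEstimate Ω) (hS : NonConcentration Ω)
    (hN : HasNegativeForm Ω) : StrictConcaveOn ℝ (Iio 0) (fun α => robinEig α Ω) := by
  refine ⟨convex_Iio 0, fun α hα β hβ hne a b ha hb hab => ?_⟩
  by_contra! hle
  simp only [smul_eq_mul] at hle
  have hα' : α < 0 := hα
  have hβ' : β < 0 := hβ
  have hlne : robinEig α Ω ≠ robinEig β Ω := (robinEig_strictMonoOn hT hN).injOn.ne hα hβ hne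
  set l := robinEig α Ω with hl
  set m := robinEig β Ω with hm
  set γ := a * α + b * β with hγ
  have hγ0 : γ < 0 := by
    have := mul_neg_of_pos_of_neg ha hα'
    have := mul_neg_of_pos_of_neg hb hβ'
    linarith
  set k := robinEig γ Ω with hk
  set d := |l - m| with hd
  have hd0 : 0 < d := abs_pos.2 (sub_ne_zero.2 hlne)
  obtain ⟨C, hC⟩ := hT (2 * -γ)⁻¹ (by have := neg_pos.2 hγ0; positivity)
  set E := 2 * (|k| + 1 + -γ * |C|) with hE
  have hE0 : 0 ≤ E := by have := neg_pos.2 hγ0; positivity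
  obtain ⟨φ, K, hφ, h01, hK, hφ0, hconc⟩ := hS (1 / (2 * (E + 1))) (by positivity)
  set C₁ := 4 * E + (4 * K ^ 2 + |l| + |m|) with hC₁
  have hC₁0 : 0 ≤ C₁ := by positivity
  set σ := min (1 / 2) (d / (2 * (C₁ + 1))) with hσ
  have hσ0 : 0 < σ := lt_min (by norm_num) (by positivity)
  have hσC : σ * C₁ ≤ d / 2 := by
    have h1 : σ ≤ d / (2 * (C₁ + 1)) := min_le_right _ _
    rw [le_div_iff₀ (by positivity)] at h1
    nlinarith
  set c := min a b with hc
  have hc0 : 0 < c := lt_min ha hb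
  set η := min 1 (c * σ * d / 4) with hη
  have hη0 : 0 < η := lt_min one_pos (by positivity)
  obtain ⟨u, hu, hu0, hlt⟩ := exists_lt_of_robinEig_lt hN hγ0 (c := k + η) (by linarith)
  have hNpos := exteriorMass_pos hu hu0
  have hT' := hC u hu
  have hconc' := hconc u hu
  have hQα := robinEig_mul_le hT hα' hu hu0
  have hQβ := robinEig_mul_le hT hβ' hu hu0
  have hpert : ∀ τ : ℝ, |τ| ≤ 1 / 2 → _ := fun τ hτ =>
    robinEig_perturb_le hT hα' hβ' hu hu0 hφ h01 hK hφ0 (τ := τ) hτ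
  rw [← hl] at hQα
  rw [← hm] at hQβ
  rw [← hl, ← hm] at hpert
  set G := dirichletEnergy Ω u
  set B := boundaryMass Ω u
  set N := exteriorMass Ω u
  set P := ∫ x in extDom Ω, φ x * u x ^ 2
  have hGE : G ≤ E * N := by
    have h1 := mul_le_mul_of_nonneg_left hT' (by linarith : 0 ≤ -γ)
    have h2 : -γ * ((2 * -γ)⁻¹ * G + C * N) = G / 2 + -γ * (C * N) := by
      have := hγ0.ne
      field_simp
      ring
    have h3 : (k + η) * N ≤ (|k| + 1) * N :=
      mul_le_mul_of_nonneg_right (add_le_add (le_abs_self k) (min_le_left _ _)) hNpos.le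
    have h4 : -γ * (C * N) ≤ -γ * (|C| * N) :=
      mul_le_mul_of_nonneg_left (mul_le_mul_of_nonneg_right (le_abs_self C) hNpos.le)
        (by linarith)
    rw [hE]
    linarith
  have hP : N / 2 ≤ P := by
    have h1 : 1 / (2 * (E + 1)) * (G + N) ≤ N / 2 := by
      rw [one_div, ← div_eq_inv_mul, div_le_div_iff₀ (by positivity) (by norm_num)]
      nlinarith
    linarith
  have hτ : ∃ τ : ℝ, |τ| = σ ∧ τ * (l - m) = σ * d := by
    rcases le_total 0 (l - m) with h | h
    · exact ⟨σ, abs_of_pos hσ0, by rw [hd, abs_of_nonneg h]⟩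
    · exact ⟨-σ, by rw [abs_neg, abs_of_pos hσ0], by rw [hd, abs_of_nonpos h]; ring⟩
  obtain ⟨τ, hτσ, hτd⟩ := hτ
  have hmain := hpert τ (hτσ ▸ min_le_left _ _)
  rw [← sq_abs τ, hτσ, mul_assoc 2 τ, hτd] at hmain
  have hsmall : c * ((G + α * B - l * N) + (G + β * B - m * N)) ≤ η * N := by
    have h1 : c * (G + α * B - l * N) ≤ a * (G + α * B - l * N) :=
      mul_le_mul_of_nonneg_right (min_le_left _ _) (by linarith)
    have h2 : c * (G + β * B - m * N) ≤ b * (G + β * B - m * N) :=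
      mul_le_mul_of_nonneg_right (min_le_right _ _) (by linarith)
    have h3 : a * (G + α * B - l * N) + b * (G + β * B - m * N) =
        G + γ * B - (a * l + b * m) * N := by
      have : b = 1 - a := by linarith
      rw [hγ, this]; ring
    have h4 : k * N ≤ (a * l + b * m) * N := mul_le_mul_of_nonneg_right hle hNpos.le
    linarith
  have hη4 : η * N ≤ c * σ * d / 4 * N := mul_le_mul_of_nonneg_right (min_le_right _ _) hNpos.le
  have h5 : (G + α * B - l * N) + (G + β * B - m * N) ≤ σ * d / 4 * N := by
    refine le_of_mul_le_mul_left ?_ hc0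
    linarith
  have h6 : 2 * (σ * d) * (N / 2) ≤ 2 * (σ * d) * P :=
    mul_le_mul_of_nonneg_left hP (by positivity)
  have h7 : σ ^ 2 * (4 * G + (4 * K ^ 2 + |l| + |m|) * N) ≤ σ * (d / 2) * N := by
    calc _ ≤ σ ^ 2 * (C₁ * N) := mul_le_mul_of_nonneg_left (by rw [hC₁]; linarith) (sq_nonneg _)
      _ = σ * (σ * C₁) * N := by ring
      _ ≤ _ := by gcongr
  have h8 : 0 < σ * d * N := by positivity
  linarith

end Abstract

/-- Coordinates `(t, s) ↦ Φ (t, s)` on a one-sided collar of the boundary inside the exterior: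
`Φ (t, 0)`, `t ∈ [0, 1]`, runs through the boundary and `s` runs through the segments in the
direction of `ν t`. The integral inequalities record that `Φ` has Jacobian between `m` and `M`
and that the boundary curve is `V`-Lipschitz. -/
structure ExteriorCollar (Ω : Set E2) where
  Φ : ℝ × ℝ → E2
  ν : ℝ → E2
  r : ℝ
  m : ℝ
  M : ℝ
  V : ℝ
  r_pos : 0 < r
  m_pos : 0 < m
  M_pos : 0 < M
  V_pos : 0 < V
  continuous_Φ : Continuous Φ
  continuous_ν : Continuous ν
  hasDerivAt_Φ : ∀ t s, HasDerivAt (fun s => Φ (t, s)) (ν t) s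
  norm_ν_le : ∀ t ∈ Icc (0 : ℝ) 1, ‖ν t‖ ≤ V
  integral_collar_le : ∀ g : E2 → ℝ, Continuous g → (∀ x, 0 ≤ g x) → Integrable g →
    m * ∫ z in Ioc (0 : ℝ) 1 ×ˢ Ioc (0 : ℝ) r, g (Φ z) ≤ ∫ x in extDom Ω, g x
  exists_nhds : ∀ h ∈ Ioc 0 r, ∃ U, IsOpen U ∧ IsBounded U ∧ closure Ω ⊆ U ∧
    ∀ g : E2 → ℝ, Continuous g → (∀ x, 0 ≤ g x) → Integrable g →
    ∫ x in extDom Ω ∩ U, g x ≤ M * ∫ z in Ioc (0 : ℝ) 1 ×ˢ Ioc (0 : ℝ) h, g (Φ z)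
  integral_frontier_le : ∀ g : E2 → ℝ, Continuous g → (∀ x, 0 ≤ g x) →
    ∫ x in frontier Ω, g x ∂(μH[1]) ≤ V * ∫ t in (0 : ℝ)..1, g (Φ (t, 0))

theorem integrableOn_Ioc_prod_Ioc {f : ℝ × ℝ → ℝ} (hf : Continuous f) (a b c d : ℝ) :
    IntegrableOn f (Ioc a b ×ˢ Ioc c d) :=
  (hf.continuousOn.integrableOn_compact (isCompact_Icc.prod isCompact_Icc)).mono_set
    (prod_mono Ioc_subset_Icc_self Ioc_subset_Icc_self)

theorem integral_Ioc_prod_Ioc {f : ℝ × ℝ → ℝ} (hf : Continuous f) {a b c d : ℝ} (hab : a ≤ b)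
    (hcd : c ≤ d) : ∫ z in Ioc a b ×ˢ Ioc c d, f z = ∫ t in a..b, ∫ s in c..d, f (t, s) := by
  rw [Measure.volume_eq_prod, setIntegral_prod _ (integrableOn_Ioc_prod_Ioc hf a b c d),
    intervalIntegral.integral_of_le hab]
  simp only [intervalIntegral.integral_of_le hcd]

theorem integral_Ioc_prod_Ioc_symm {f : ℝ × ℝ → ℝ} (hf : Continuous f) {a b c d : ℝ} (hab : a ≤ b)
    (hcd : c ≤ d) : ∫ z in Ioc a b ×ˢ Ioc c d, f z = ∫ s in c..d, ∫ t in a..b, f (t, s) := by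
  have h := integrableOn_Ioc_prod_Ioc hf a b c d
  rw [IntegrableOn, Measure.volume_eq_prod, ← Measure.prod_restrict] at h
  rw [Measure.volume_eq_prod, ← Measure.prod_restrict, integral_prod_symm _ h,
    intervalIntegral.integral_of_le hcd]
  simp only [intervalIntegral.integral_of_le hab]

namespace ExteriorCollar

variable {Ω : Set E2} (c : ExteriorCollar Ω)

/-- The `L²` norm on a curve parallel to the boundary is controlled by the `H¹` norm. -/
theorem integral_parallel_le {u : E2 → ℝ} (hu : IsTestFun u) {ε s : ℝ} (hε : 0 < ε)
    (hs : s ∈ Icc 0 c.r) : ∫ t in (0 : ℝ)..1, u (c.Φ (t, s)) ^ 2 ≤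
      ((1 / c.r + 1 / ε) * exteriorMass Ω u + ε * c.V ^ 2 * dirichletEnergy Ω u) / c.m := by
  have hΦ := c.continuous_Φ
  have hν := c.continuous_ν
  have huc := hu.continuous
  have hduc := hu.continuous_fderiv
  have hr := c.r_pos
  have hc1 : Continuous fun t => ∫ s in (0 : ℝ)..c.r, u (c.Φ (t, s)) ^ 2 :=
    intervalIntegral.continuous_parametric_intervalIntegral_of_continuous'
      (f := fun t s => u (c.Φ (t, s)) ^ 2) (by fun_prop) 0 c.r
  have hc2 : Continuous fun t => ∫ s in (0 : ℝ)..c.r, ‖fderiv ℝ u (c.Φ (t, s))‖ ^ 2 :=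
    intervalIntegral.continuous_parametric_intervalIntegral_of_continuous'
      (f := fun t s => ‖fderiv ℝ u (c.Φ (t, s))‖ ^ 2) (by fun_prop) 0 c.r
  have hpt : ∀ t ∈ Icc (0 : ℝ) 1, u (c.Φ (t, s)) ^ 2 ≤
      (1 / c.r + 1 / ε) * (∫ s in (0 : ℝ)..c.r, u (c.Φ (t, s)) ^ 2) +
      ε * c.V ^ 2 * ∫ s in (0 : ℝ)..c.r, ‖fderiv ℝ u (c.Φ (t, s))‖ ^ 2 := by
    intro t ht
    have hd : ∀ s, HasDerivAt (fun s => u (c.Φ (t, s))) (fderiv ℝ u (c.Φ (t, s)) (c.ν t)) s :=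
      fun s => (hu.differentiable _).hasFDerivAt.comp_hasDerivAt s (c.hasDerivAt_Φ t s)
    have hdc : Continuous fun s => fderiv ℝ u (c.Φ (t, s)) (c.ν t) := by fun_prop
    refine (sq_le_integral_sq_add_integral_deriv_sq hd hdc hr hε hs).trans ?_
    rw [mul_assoc ε, ← intervalIntegral.integral_const_mul (c.V ^ 2)]
    gcongr
    refine intervalIntegral.integral_mono_on hr.le
      ((hdc.pow 2).intervalIntegrable _ _)
      (Continuous.intervalIntegrable (by fun_prop) _ _) fun s _ => ?_
    rw [← sq_abs, ← mul_pow]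
    refine pow_le_pow_left₀ (abs_nonneg _) ?_ 2
    refine ((fderiv ℝ u (c.Φ (t, s))).le_opNorm _).trans ?_
    rw [mul_comm]
    exact mul_le_mul_of_nonneg_right (c.norm_ν_le t ht) (norm_nonneg _)
  have h1 := intervalIntegral.integral_mono_on zero_le_one
    (Continuous.intervalIntegrable (by fun_prop) _ _)
    (Continuous.intervalIntegrable (by fun_prop) _ _) hpt (μ := volume)
  rw [intervalIntegral.integral_add (Continuous.intervalIntegrable (by fun_prop) _ _)
    (Continuous.intervalIntegrable (by fun_prop) _ _), intervalIntegral.integral_const_mul,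
    intervalIntegral.integral_const_mul,
    ← integral_Ioc_prod_Ioc (f := fun z => u (c.Φ z) ^ 2) (by fun_prop) zero_le_one hr.le,
    ← integral_Ioc_prod_Ioc (f := fun z => ‖fderiv ℝ u (c.Φ z)‖ ^ 2) (by fun_prop)
      zero_le_one hr.le] at h1
  refine h1.trans ?_
  rw [le_div_iff₀ c.m_pos]
  have h2 := c.integral_collar_le (fun x => u x ^ 2) (by fun_prop) (fun x => by positivity)
    hu.integrable_sq
  have h3 := c.integral_collar_le (fun x => ‖fderiv ℝ u x‖ ^ 2) (by fun_prop)
    (fun x => by positivity) hu.integrable_fderiv_sq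
  have h4 := mul_le_mul_of_nonneg_left h2 (by positivity : 0 ≤ 1 / c.r + 1 / ε)
  have h5 := mul_le_mul_of_nonneg_left h3 (by positivity : 0 ≤ ε * c.V ^ 2)
  simp only [exteriorMass, dirichletEnergy]
  linarith

theorem traceEstimate (c : ExteriorCollar Ω) : TraceEstimate Ω := by
  intro ε hε
  have hm := c.m_pos
  have hV := c.V_pos
  set δ := ε * c.m / c.V ^ 3 with hδ
  have hδ0 : 0 < δ := by positivity
  refine ⟨c.V * (1 / c.r + 1 / δ) / c.m, fun u hu => ?_⟩
  have huc := hu.continuous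
  have h1 := c.integral_frontier_le (fun x => u x ^ 2) (by fun_prop) fun x => by positivity
  have h2 := mul_le_mul_of_nonneg_left
    (c.integral_parallel_le hu hδ0 ⟨le_rfl, c.r_pos.le⟩) hV.le
  refine (h1.trans h2).trans (le_of_eq ?_)
  have h3 : δ * c.V ^ 2 = ε * c.m / c.V := by rw [hδ]; field_simp
  rw [h3]
  field_simp
  ring

theorem nonConcentration (c : ExteriorCollar Ω) : NonConcentration Ω := by
  intro η hη
  have hm := c.m_pos
  have hM := c.M_pos
  have hr := c.r_pos
  have hV := c.V_pos
  set A := (1 / c.r + 1 / 1 + c.V ^ 2) / c.m with hA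
  have hA0 : 0 < A := by positivity
  set h := min c.r (η / (c.M * A)) with hh
  have hh0 : 0 < h := lt_min hr (by positivity)
  have hhA : c.M * (h * A) ≤ η := by
    have : h ≤ η / (c.M * A) := min_le_right _ _
    rw [le_div_iff₀ (by positivity)] at this
    linarith
  obtain ⟨U, hUo, hUb, hU, hUi⟩ := c.exists_nhds h ⟨hh0, min_le_left _ _⟩
  obtain ⟨φ, hφs, hφr, hφ0, hφ1⟩ := exists_contMDiff_zero_iff_one_iff_of_isClosed
    (modelWithCornersSelf ℝ E2) (n := (⊤ : ℕ∞)) isClosed_closure hUo.isClosed_compl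
    (disjoint_compl_right_iff_subset.2 hU)
  have hφd : ContDiff ℝ (⊤ : ℕ∞) φ := hφs.contDiff
  have h01 : ∀ x, φ x ∈ Icc 0 1 := fun x => hφr (mem_range_self x)
  have hsupp : HasCompactSupport fun x => 1 - φ x := by
    refine HasCompactSupport.intro hUb.isCompact_closure fun x hx => ?_
    rw [(hφ1 x).1 fun hxU => hx (subset_closure hxU), sub_self]
  obtain ⟨K, hK⟩ := Continuous.bounded_above_of_compact_support
    ((contDiff_const (c := (1 : ℝ)).sub hφd).continuous_fderiv (by simp)) (hsupp.fderiv ℝ)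
  refine ⟨φ, K, hφd, h01, fun x => ?_, fun x hx => (hφ0 x).1 (frontier_subset_closure hx), ?_⟩
  · have := hK x
    rwa [fderiv_const_sub, norm_neg] at this
  · intro u hu
    have huc := hu.continuous
    have hΦ := c.continuous_Φ
    have hcollar : ∫ z in Ioc (0 : ℝ) 1 ×ˢ Ioc (0 : ℝ) h, u (c.Φ z) ^ 2 ≤
        h * (A * (dirichletEnergy Ω u + exteriorMass Ω u)) := by
      rw [integral_Ioc_prod_Ioc_symm (f := fun z => u (c.Φ z) ^ 2) (by fun_prop) zero_le_one hh0.le]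
      have hb : ∀ s ∈ Icc 0 h, ∫ t in (0 : ℝ)..1, u (c.Φ (t, s)) ^ 2 ≤
          A * (dirichletEnergy Ω u + exteriorMass Ω u) := fun s hs => by
        refine (c.integral_parallel_le hu one_pos
          ⟨hs.1, hs.2.trans (min_le_left _ _)⟩).trans ?_
        rw [hA, div_mul_eq_mul_div]
        gcongr
        have h1 := dirichletEnergy_nonneg Ω u
        have h2 := exteriorMass_nonneg Ω u
        have h3 : 0 ≤ (1 / c.r + 1 / 1) * dirichletEnergy Ω u := by positivity
        have h4 : 0 ≤ c.V ^ 2 * exteriorMass Ω u := by positivity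
        linarith
      have hc1 : Continuous fun s => ∫ t in (0 : ℝ)..1, u (c.Φ (t, s)) ^ 2 :=
        intervalIntegral.continuous_parametric_intervalIntegral_of_continuous'
          (f := fun s t => u (c.Φ (t, s)) ^ 2) (by fun_prop) 0 1
      have := intervalIntegral.integral_mono_on (μ := volume) hh0.le (hc1.intervalIntegrable _ _)
        intervalIntegrable_const hb
      rwa [intervalIntegral.integral_const, sub_zero, smul_eq_mul] at this
    have hi := hu.integrable_sq
    have hsplit : exteriorMass Ω u ≤ (∫ x in extDom Ω ∩ U, u x ^ 2) +
        ∫ x in extDom Ω, φ x * u x ^ 2 := by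
      rw [← setIntegral_indicator hUo.measurableSet,
        ← integral_add (hi.indicator hUo.measurableSet).restrict
          (hu.integrable_mul_sq hφd.continuous).restrict]
      refine integral_mono hi.restrict ((hi.indicator hUo.measurableSet).restrict.add
          (hu.integrable_mul_sq hφd.continuous).restrict) fun x => ?_
      by_cases hx : x ∈ U
      · simp only [indicator_of_mem hx]
        exact le_add_of_nonneg_right (mul_nonneg (h01 x).1 (sq_nonneg _))
      · simp [indicator_of_notMem hx, (hφ1 x).1 hx]
    have h1 := hUi (fun x => u x ^ 2) (by fun_prop) (fun x => by positivity) hi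
    have h2 := mul_le_mul_of_nonneg_left hcollar hM.le
    have h3 := mul_le_mul_of_nonneg_right hhA
      (add_nonneg (dirichletEnergy_nonneg Ω u) (exteriorMass_nonneg Ω u))
    linarith

end ExteriorCollar

theorem hasNegativeForm {Ω : Set E2} (hb : IsBounded Ω) (hne : (extDom Ω).Nonempty)
    (hpos : 0 < μH[1] (frontier Ω)) (hfin : μH[1] (frontier Ω) ≠ ⊤) : HasNegativeForm Ω := by
  intro α hα
  obtain ⟨x₀, hx₀⟩ := hne
  obtain ⟨R, hR⟩ := (hb.closure.subset frontier_subset_closure).exists_norm_le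
  have hL : 0 < (μH[1] : Measure E2).real (frontier Ω) := ENNReal.toReal_pos hpos.ne' hfin
  obtain ⟨u, hus, huc, hu1, hlt⟩ := exists_cutoff_dirichlet_lt (max R ‖x₀‖)
    (mul_pos (neg_pos.2 hα) hL)
  have hu : IsTestFun u := ⟨hus, huc⟩
  refine ⟨u, hu, ⟨x₀, hx₀, by simp [hu1 x₀ (le_max_right _ _)]⟩, ?_⟩
  have hB : boundaryMass Ω u = (μH[1] : Measure E2).real (frontier Ω) := by
    rw [boundaryMass, setIntegral_congr_fun (g := fun _ => (1 : ℝ))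
      isClosed_frontier.measurableSet fun x hx => by
        simp [hu1 x ((hR x hx).trans (le_max_left _ _))]]
    simp
  have hE : dirichletEnergy Ω u ≤ ∫ x, ‖fderiv ℝ u x‖ ^ 2 :=
    setIntegral_le_integral hu.integrable_fderiv_sq (ae_of_all _ fun _ => by positivity)
  rw [hB]
  linarith

/-- The linear identification of `ℝ × ℝ` with the Euclidean plane. -/
def planeEquiv : (ℝ × ℝ) ≃L[ℝ] E2 :=
  (ContinuousLinearEquiv.finTwoArrow ℝ ℝ).symm.trans (EuclideanSpace.equiv (Fin 2) ℝ).symm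

theorem measurePreserving_planeEquiv : MeasurePreserving planeEquiv :=
  (EuclideanSpace.volume_preserving_symm_measurableEquiv_toLp (Fin 2)).symm.comp
    ((volume_preserving_finTwoArrow ℝ).symm)

/-- A smooth closed parametrisation `γ` of the boundary of `Ω`, injective up to the period,
together with a smooth periodic vector field `ν` transversal to it. -/
structure BoundaryFrame (Ω : Set E2) where
  γ : ℝ → E2
  ν : ℝ → E2
  contDiff_γ : ContDiff ℝ (⊤ : ℕ∞) γ
  contDiff_ν : ContDiff ℝ (⊤ : ℕ∞) ν
  γ_add_one : ∀ t, γ (t + 1) = γ t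
  ν_add_one : ∀ t, ν (t + 1) = ν t
  range_γ : range γ = frontier Ω
  exists_int : ∀ t t', γ t = γ t' → ∃ n : ℤ, t' = t + n
  transversal : ∀ t, deriv γ t 0 * ν t 1 - ν t 0 * deriv γ t 1 ≠ 0

namespace BoundaryFrame

variable {Ω : Set E2} (F : BoundaryFrame Ω)

/-- The map sending `(t, s)` to the point `γ t + s ν t`. -/
def map (z : ℝ × ℝ) : E2 := F.γ z.1 + z.2 • F.ν z.1

/-- The Jacobian determinant of `BoundaryFrame.map`. -/
def jac (z : ℝ × ℝ) : ℝ :=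
  (deriv F.γ z.1 0 + z.2 * deriv F.ν z.1 0) * F.ν z.1 1 -
    F.ν z.1 0 * (deriv F.γ z.1 1 + z.2 * deriv F.ν z.1 1)

/-- The derivative of `BoundaryFrame.map` in Cartesian coordinates. -/
def fderivChart (z : ℝ × ℝ) : ℝ × ℝ →L[ℝ] ℝ × ℝ :=
  (Matrix.toLin (.finTwoProd ℝ) (.finTwoProd ℝ)
    !![deriv F.γ z.1 0 + z.2 * deriv F.ν z.1 0, F.ν z.1 0;
      deriv F.γ z.1 1 + z.2 * deriv F.ν z.1 1, F.ν z.1 1]).toContinuousLinearMap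

theorem det_fderivChart (z : ℝ × ℝ) : (F.fderivChart z).det = F.jac z := by
  simp only [fderivChart, jac, LinearMap.det_toContinuousLinearMap, LinearMap.det_toLin,
    Matrix.det_fin_two_of]

theorem contDiff_map : ContDiff ℝ (⊤ : ℕ∞) F.map := by
  have h1 := F.contDiff_γ
  have h2 := F.contDiff_ν
  unfold map
  fun_prop

theorem continuous_map : Continuous F.map := F.contDiff_map.continuous

theorem continuous_jac : Continuous F.jac := by
  have h1 := F.contDiff_γ.continuous_deriv (by simp)
  have h2 := F.contDiff_ν.continuous_deriv (by simp)
  have h3 := F.contDiff_ν.continuous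
  unfold jac
  fun_prop

theorem hasDerivAt_γ (t : ℝ) : HasDerivAt F.γ (deriv F.γ t) t :=
  (F.contDiff_γ.differentiable (by simp) t).hasDerivAt

theorem hasDerivAt_ν (t : ℝ) : HasDerivAt F.ν (deriv F.ν t) t :=
  (F.contDiff_ν.differentiable (by simp) t).hasDerivAt

theorem hasFDerivAt_chart (z : ℝ × ℝ) :
    HasFDerivAt (fun z => planeEquiv.symm (F.map z)) (F.fderivChart z) z := by
  have key : ∀ i, HasFDerivAt (fun z : ℝ × ℝ => F.γ z.1 i + z.2 * F.ν z.1 i)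
      ((deriv F.γ z.1 i + z.2 * deriv F.ν z.1 i) • ContinuousLinearMap.fst ℝ ℝ ℝ +
        F.ν z.1 i • ContinuousLinearMap.snd ℝ ℝ ℝ) z := by
    intro i
    have h1 : HasDerivAt (fun t => F.γ t i) (deriv F.γ z.1 i) z.1 :=
      (EuclideanSpace.proj (𝕜 := ℝ) i).hasFDerivAt.comp_hasDerivAt z.1 (F.hasDerivAt_γ z.1)
    have h2 : HasDerivAt (fun t => F.ν t i) (deriv F.ν z.1 i) z.1 :=
      (EuclideanSpace.proj (𝕜 := ℝ) i).hasFDerivAt.comp_hasDerivAt z.1 (F.hasDerivAt_ν z.1)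
    convert! (h1.comp_hasFDerivAt z (hasFDerivAt_fst (𝕜 := ℝ) (p := z))).add
      ((hasFDerivAt_snd (𝕜 := ℝ) (p := z)).mul
        (h2.comp_hasFDerivAt z (hasFDerivAt_fst (𝕜 := ℝ) (p := z)))) using 1
    ext <;> simp
  rw [fderivChart, Matrix.toLin_finTwoProd_toContinuousLinearMap]
  exact (key 0).prodMk (key 1)

/-- The derivative of `BoundaryFrame.map` as an isomorphism where the Jacobian is nonzero. -/
def fderivEquiv {z : ℝ × ℝ} (hz : F.jac z ≠ 0) : (ℝ × ℝ) ≃L[ℝ] E2 :=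
  ((F.fderivChart z).toContinuousLinearEquivOfDetNeZero
    (by rwa [F.det_fderivChart])).trans planeEquiv

theorem hasStrictFDerivAt_map {z : ℝ × ℝ} (hz : F.jac z ≠ 0) :
    HasStrictFDerivAt F.map (F.fderivEquiv hz : (ℝ × ℝ) →L[ℝ] E2) z := by
  refine F.contDiff_map.contDiffAt.hasStrictFDerivAt' ?_ (by simp)
  convert! (planeEquiv : (ℝ × ℝ) →L[ℝ] E2).hasFDerivAt.comp z (F.hasFDerivAt_chart z) using 1
  ext1 z
  simp

theorem map_nhds {z : ℝ × ℝ} (hz : F.jac z ≠ 0) : Filter.map F.map (nhds z) = nhds (F.map z) :=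
  (F.hasStrictFDerivAt_map hz).map_nhds_eq_of_equiv

theorem eventually_injective {z : ℝ × ℝ} (hz : F.jac z ≠ 0) : ∃ u ∈ nhds z, InjOn F.map u := by
  have h := F.hasStrictFDerivAt_map hz
  refine ⟨(h.toOpenPartialHomeomorph F.map).source,
    (h.toOpenPartialHomeomorph F.map).open_source.mem_nhds h.mem_toOpenPartialHomeomorph_source,
    ?_⟩
  exact (h.toOpenPartialHomeomorph F.map).injOn

theorem γ_add_int (t : ℝ) (n : ℤ) : F.γ (t + n) = F.γ t := by
  have h : Function.Periodic F.γ 1 := F.γ_add_one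
  simpa using h.int_mul n t

theorem ν_add_int (t : ℝ) (n : ℤ) : F.ν (t + n) = F.ν t := by
  have h : Function.Periodic F.ν 1 := F.ν_add_one
  simpa using h.int_mul n t

theorem map_add_int (t s : ℝ) (n : ℤ) : F.map (t + n, s) = F.map (t, s) := by
  simp [map, F.γ_add_int, F.ν_add_int]

theorem map_zero (t : ℝ) : F.map (t, 0) = F.γ t := by simp [map]

theorem exists_map_Ioc (t s : ℝ) : ∃ t' ∈ Ioc (0 : ℝ) 1, F.map (t', s) = F.map (t, s) := by
  obtain ⟨n, hn, -⟩ := existsUnique_add_zsmul_mem_Ioc one_pos t 0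
  refine ⟨t + n, by simpa using hn, F.map_add_int t s n⟩

/-- `F.map` is injective, up to the period, on a strip around the boundary curve. -/
def IsInjStrip (δ : ℝ) : Prop :=
  ∀ t t' s s', |s| < δ → |s'| < δ → F.map (t, s) = F.map (t', s') →
    s = s' ∧ ∃ n : ℤ, t' = t + n

theorem exists_isInjStrip : ∃ δ > 0, F.IsInjStrip δ := by
  have hc := F.continuous_map
  have hloc : ∀ p ∈ Icc (0 : ℝ) 1 ×ˢ Icc (0 : ℝ) 1,
      ∀ᶠ z : (ℝ × ℝ) × (ℝ × ℝ) in nhds (((0 : ℝ), (0 : ℝ)), p),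
      F.map (z.2.1, z.1.1) = F.map (z.2.2, z.1.2) →
        z.1.1 = z.1.2 ∧ ∃ n : ℤ, z.2.2 = z.2.1 + (n : ℝ) := by
    rintro ⟨t, t'⟩ -
    by_cases h : F.γ t = F.γ t'
    · obtain ⟨n, rfl⟩ := F.exists_int t t' h
      obtain ⟨u, hu, hinj⟩ := F.eventually_injective (z := (t, 0))
        (by simpa [jac] using F.transversal t)
      have h1 : Tendsto (fun z : (ℝ × ℝ) × (ℝ × ℝ) => (z.2.1, z.1.1))
          (nhds ((0, 0), (t, t + n))) (nhds (t, 0)) :=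
        Continuous.tendsto' (by fun_prop) _ _ rfl
      have h2 : Tendsto (fun z : (ℝ × ℝ) × (ℝ × ℝ) => (z.2.2 - n, z.1.2))
          (nhds ((0, 0), (t, t + n))) (nhds (t, 0)) :=
        Continuous.tendsto' (by fun_prop) _ _ (by simp)
      filter_upwards [h1 hu, h2 hu] with z hz1 hz2 hz
      have := hinj hz1 hz2 (by
        rw [hz, ← F.map_add_int (z.2.2 - n) z.1.2 n, sub_add_cancel])
      rw [Prod.mk.injEq] at this
      exact ⟨this.2, n, by rw [this.1]; ring⟩
    · have h1 : Continuous fun z : (ℝ × ℝ) × (ℝ × ℝ) => F.map (z.2.1, z.1.1) := by fun_prop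
      have h2 : Continuous fun z : (ℝ × ℝ) × (ℝ × ℝ) => F.map (z.2.2, z.1.2) := by fun_prop
      filter_upwards [(isOpen_ne_fun h1 h2).mem_nhds
        (show F.map (t, 0) ≠ F.map (t', 0) by simpa only [map_zero] using h)] with z hz hz'
      exact absurd hz' hz
  have hev := (isCompact_Icc.prod isCompact_Icc).eventually_forall_of_forall_eventually
    (P := fun (q p : ℝ × ℝ) => F.map (p.1, q.1) = F.map (p.2, q.2) →
      q.1 = q.2 ∧ ∃ n : ℤ, p.2 = p.1 + (n : ℝ)) hloc
  obtain ⟨δ, hδ, hball⟩ := Metric.eventually_nhds_iff.1 hev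
  refine ⟨δ, hδ, fun t t' s s' hs hs' h => ?_⟩
  have := @hball (s, s') (by simpa [Prod.dist_eq] using ⟨hs, hs'⟩) (Int.fract t, Int.fract t')
    ⟨⟨Int.fract_nonneg t, (Int.fract_lt_one t).le⟩,
      ⟨Int.fract_nonneg t', (Int.fract_lt_one t').le⟩⟩
    (by
      rw [← F.map_add_int (Int.fract t) s ⌊t⌋, ← F.map_add_int (Int.fract t') s' ⌊t'⌋,
        Int.fract_add_floor, Int.fract_add_floor, h])
  obtain ⟨h1, n, hn⟩ := this
  refine ⟨h1, n + ⌊t'⌋ - ⌊t⌋, ?_⟩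
  have e1 := Int.fract_add_floor t
  have e2 := Int.fract_add_floor t'
  simp only at hn
  push_cast
  linarith

theorem jac_add_int (t s : ℝ) (n : ℤ) : F.jac (t + n, s) = F.jac (t, s) := by
  have h1 : deriv F.γ (t + n) = deriv F.γ t := by
    rw [← deriv_comp_add_const]
    exact congrArg (fun f => deriv f t) (funext fun x => F.γ_add_int x n)
  have h2 : deriv F.ν (t + n) = deriv F.ν t := by
    rw [← deriv_comp_add_const]
    exact congrArg (fun f => deriv f t) (funext fun x => F.ν_add_int x n)
  simp [jac, h1, h2, F.ν_add_int]

theorem exists_jac_bounds : ∃ δ > 0, ∃ m > 0, ∃ M > 0, ∀ t s, |s| < δ →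
    m ≤ |F.jac (t, s)| ∧ |F.jac (t, s)| ≤ M := by
  have hj := F.continuous_jac
  have hj0 : Continuous fun t => |F.jac (t, 0)| := by fun_prop
  obtain ⟨t₀, -, hmin⟩ := isCompact_Icc.exists_isMinOn (nonempty_Icc.2 zero_le_one)
    (hj0.continuousOn (s := Icc (0 : ℝ) 1))
  obtain ⟨t₁, -, hmax⟩ := isCompact_Icc.exists_isMaxOn (nonempty_Icc.2 zero_le_one)
    (hj0.continuousOn (s := Icc (0 : ℝ) 1))
  have hpos : ∀ t, 0 < |F.jac (t, 0)| := fun t =>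
    abs_pos.2 (by simpa [jac] using F.transversal t)
  have hev := (isCompact_Icc (a := (0 : ℝ)) (b := 1)).eventually_forall_of_forall_eventually
    (x₀ := (0 : ℝ)) (P := fun s t => |F.jac (t₀, 0)| / 2 < |F.jac (t, s)| ∧
      |F.jac (t, s)| < 2 * |F.jac (t₁, 0)|) (by
    intro t ht
    have hc : Continuous fun z : ℝ × ℝ => |F.jac (z.2, z.1)| := by fun_prop
    refine (hc.continuousAt.eventually (lt_mem_nhds ?_)).and
      (hc.continuousAt.eventually (gt_mem_nhds ?_))
    · have := hmin ht
      simp only [mem_ofPred_eq] at this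
      linarith [hpos t₀]
    · have := hmax ht
      simp only [mem_ofPred_eq] at this
      linarith [hpos t₁])
  obtain ⟨δ, hδ, hball⟩ := Metric.eventually_nhds_iff.1 hev
  refine ⟨δ, hδ, _, half_pos (hpos t₀), _, mul_pos two_pos (hpos t₁), fun t s hs => ?_⟩
  have := @hball s (by simpa using hs) (Int.fract t)
    ⟨Int.fract_nonneg t, (Int.fract_lt_one t).le⟩
  rw [← F.jac_add_int (Int.fract t) s ⌊t⌋, Int.fract_add_floor] at this
  exact ⟨this.1.le, this.2.le⟩

end BoundaryFrame

theorem subset_or_subset_extDom {Ω A : Set E2} (ho : IsOpen Ω) (hA : IsPreconnected A)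
    (hd : ∀ x ∈ A, x ∉ frontier Ω) : A ⊆ Ω ∨ A ⊆ extDom Ω := by
  refine hA.subset_or_subset ho (isOpen_extDom Ω) ?_ fun x hx => ?_
  · exact disjoint_compl_right.mono_left subset_closure
  · by_cases h : x ∈ closure Ω
    · rw [closure_eq_self_union_frontier] at h
      exact Or.inl (h.resolve_right (hd x hx))
    · exact Or.inr h

namespace BoundaryFrame

variable {Ω : Set E2} (F : BoundaryFrame Ω)

/-- The frame with the opposite transversal field. -/
def neg : BoundaryFrame Ω where
  γ := F.γ
  ν := fun t => -F.ν t
  contDiff_γ := F.contDiff_γ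
  contDiff_ν := F.contDiff_ν.neg
  γ_add_one := F.γ_add_one
  ν_add_one t := by rw [F.ν_add_one]
  range_γ := F.range_γ
  exists_int := F.exists_int
  transversal t h := F.transversal t (by
    simp only [PiLp.neg_apply] at h
    linarith)

theorem map_neg (t s : ℝ) : F.neg.map (t, s) = F.map (t, -s) := by
  simp [map, neg]

theorem γ_mem_frontier (t : ℝ) : F.γ t ∈ frontier Ω := by
  rw [← F.range_γ]
  exact mem_range_self t

/-- The open strip of width `2 * h` around the boundary curve. -/
def strip (h : ℝ) : Set E2 := F.map '' (univ ×ˢ Ioo (-h) h)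

theorem isOpen_strip {h : ℝ} (hj : ∀ t s, |s| < h → F.jac (t, s) ≠ 0) : IsOpen (F.strip h) := by
  rw [isOpen_iff_mem_nhds]
  rintro _ ⟨⟨t, s⟩, hz, rfl⟩
  rw [← F.map_nhds (hj t s (abs_lt.2 hz.2))]
  exact image_mem_map ((isOpen_univ.prod isOpen_Ioo).mem_nhds hz)

theorem isBounded_strip (h : ℝ) : IsBounded (F.strip h) := by
  have hK : IsCompact (F.map '' (Icc (0 : ℝ) 1 ×ˢ Icc (-h) h)) :=
    (isCompact_Icc.prod isCompact_Icc).image F.continuous_map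
  refine hK.isBounded.subset ?_
  rintro _ ⟨⟨t, s⟩, hz, rfl⟩
  obtain ⟨t', ht', h'⟩ := F.exists_map_Ioc t s
  exact ⟨(t', s), ⟨Ioc_subset_Icc_self ht', Ioo_subset_Icc_self hz.2⟩, h'⟩

theorem frontier_subset_strip {h : ℝ} (hh : 0 < h) : frontier Ω ⊆ F.strip h := by
  rw [← F.range_γ]
  rintro _ ⟨t, rfl⟩
  exact ⟨(t, 0), ⟨mem_univ _, by simpa using hh⟩, F.map_zero t⟩

/-- `F.map` maps positive `s` to the exterior and negative `s` to the interior. -/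
def IsOutward (δ : ℝ) : Prop :=
  (∀ t, ∀ s ∈ Ioo 0 δ, F.map (t, s) ∈ extDom Ω) ∧ ∀ t, ∀ s ∈ Ioo (-δ) 0, F.map (t, s) ∈ Ω

theorem exists_isOutward_or_neg (ho : IsOpen Ω) (hne : Ω.Nonempty) (hext : (extDom Ω).Nonempty) :
    ∃ δ > 0, F.IsOutward δ ∨ F.neg.IsOutward δ := by
  obtain ⟨δ₁, hδ₁, hinj⟩ := F.exists_isInjStrip
  obtain ⟨δ₂, hδ₂, m, hm, M, -, hjac⟩ := F.exists_jac_bounds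
  obtain ⟨δ, hδ, h1, h2⟩ : ∃ δ > 0, δ ≤ δ₁ ∧ δ ≤ δ₂ :=
    ⟨min δ₁ δ₂, lt_min hδ₁ hδ₂, min_le_left _ _, min_le_right _ _⟩
  have hside : ∀ a b, (∀ s ∈ Ioo a b, |s| < δ ∧ s ≠ 0) →
      F.map '' (univ ×ˢ Ioo a b) ⊆ Ω ∨ F.map '' (univ ×ˢ Ioo a b) ⊆ extDom Ω := by
    intro a b hab
    refine subset_or_subset_extDom ho
      ((isPreconnected_univ.prod isPreconnected_Ioo).image _ F.continuous_map.continuousOn) ?_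
    rintro _ ⟨⟨t, s⟩, hz, rfl⟩ hf
    rw [← F.range_γ] at hf
    obtain ⟨t', ht'⟩ := hf
    rw [← F.map_zero] at ht'
    obtain ⟨hs, hs0⟩ := hab s hz.2
    exact hs0 (hinj t' t 0 s (by simpa using hδ₁) (hs.trans_le h1) ht').1.symm
  have hopen : IsOpen (F.strip δ) := F.isOpen_strip fun t s hs h0 => by
    have := (hjac t s (hs.trans_le h2)).1
    rw [h0, abs_zero] at this
    linarith
  have hfr := F.frontier_subset_strip hδ
  refine ⟨δ, hδ, ?_⟩
  rcases hside 0 δ fun s hs => ⟨by rw [abs_of_pos hs.1]; exact hs.2, hs.1.ne'⟩ with hp | hp <;>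
  rcases hside (-δ) 0 fun s hs => ⟨by rw [abs_of_neg hs.2]; linarith [hs.1], hs.2.ne⟩ with hn | hn
  · exfalso
    have hcl : closure Ω = Ω ∪ F.strip δ := by
      rw [closure_eq_self_union_frontier]
      refine subset_antisymm (union_subset_union_right _ hfr) (union_subset subset_union_left ?_)
      rintro _ ⟨⟨t, s⟩, ⟨-, hs⟩, rfl⟩
      rcases lt_trichotomy s 0 with h | rfl | h
      · exact Or.inl (hn ⟨(t, s), ⟨mem_univ _, hs.1, h⟩, rfl⟩)
      · exact Or.inr (F.map_zero t ▸ F.γ_mem_frontier t)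
      · exact Or.inl (hp ⟨(t, s), ⟨mem_univ _, h, hs.2⟩, rfl⟩)
    have hclopen : IsClopen (closure Ω) := ⟨isClosed_closure, hcl ▸ ho.union hopen⟩
    rcases isClopen_iff.1 hclopen with h | h
    · exact hne.closure.ne_empty h
    · exact hext.ne_empty (by rw [extDom, h, compl_univ])
  · right
    refine ⟨fun t s hs => ?_, fun t s hs => ?_⟩ <;> rw [map_neg]
    · exact hn ⟨(t, -s), ⟨mem_univ _, by simpa using hs.2, by simpa using hs.1⟩, rfl⟩
    · exact hp ⟨(t, -s), ⟨mem_univ _, by simpa using hs.2, by linarith [hs.1]⟩, rfl⟩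
  · left
    exact ⟨fun t s hs => hp ⟨(t, s), ⟨mem_univ _, hs⟩, rfl⟩,
      fun t s hs => hn ⟨(t, s), ⟨mem_univ _, hs⟩, rfl⟩⟩
  · exfalso
    obtain ⟨_, ⟨⟨t, s⟩, ⟨-, hs⟩, rfl⟩, hx⟩ := mem_closure_iff.1
      (frontier_subset_closure (F.γ_mem_frontier 0)) _ hopen (hfr (F.γ_mem_frontier 0))
    rcases lt_trichotomy s 0 with h | rfl | h
    · exact hn ⟨(t, s), ⟨mem_univ _, hs.1, h⟩, rfl⟩ (subset_closure hx)
    · rw [F.map_zero] at hx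
      exact (ho.inter_frontier_eq ▸ (⟨hx, F.γ_mem_frontier t⟩ : F.γ t ∈ Ω ∩ frontier Ω) :
        F.γ t ∈ (∅ : Set E2))
    · exact hp ⟨(t, s), ⟨mem_univ _, h, hs.2⟩, rfl⟩ (subset_closure hx)

theorem setIntegral_image_map {δ : ℝ} (hinj : F.IsInjStrip δ) {A : Set (ℝ × ℝ)}
    (hA : MeasurableSet A) (hsub : A ⊆ Ioc (0 : ℝ) 1 ×ˢ Ioo (-δ) δ) (g : E2 → ℝ) :
    ∫ x in F.map '' A, g x = ∫ z in A, |F.jac z| * g (F.map z) := by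
  have hmapinj : InjOn F.map A := by
    rintro ⟨t, s⟩ hz ⟨t', s'⟩ hz' h
    obtain ⟨⟨ht, hs⟩, ht', hs'⟩ := hsub hz, hsub hz'
    obtain ⟨rfl, n, hn⟩ := hinj t t' s s' (abs_lt.2 hs) (abs_lt.2 hs') h
    simp only at ht ht' hn
    have h1 : (n : ℝ) < 1 := by linarith [ht.1, ht'.2]
    have h2 : (-1 : ℝ) < n := by linarith [ht.2, ht'.1]
    have : n = 0 := by
      have h1' : n < 1 := by exact_mod_cast h1
      have h2' : -1 < n := by exact_mod_cast h2
      omega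
    rw [hn, this, Int.cast_zero, add_zero]
  have himage : F.map '' A = planeEquiv '' ((fun z => planeEquiv.symm (F.map z)) '' A) := by
    rw [image_image]
    simp
  rw [himage, measurePreserving_planeEquiv.setIntegral_image_emb
    planeEquiv.toHomeomorph.measurableEmbedding,
    integral_image_eq_integral_abs_det_fderiv_smul volume hA
      (fun z _ => (F.hasFDerivAt_chart z).hasFDerivWithinAt)
      (planeEquiv.symm.injective.comp_injOn hmapinj)]
  simp [det_fderivChart]

theorem frontier_eq_image_Ioc : frontier Ω = F.γ '' Ioc 0 1 := by
  refine subset_antisymm ?_ ?_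
  · rw [← F.range_γ]
    rintro _ ⟨t, rfl⟩
    obtain ⟨t', ht', h⟩ := F.exists_map_Ioc t 0
    exact ⟨t', ht', by simpa only [map_zero] using h⟩
  · rintro _ ⟨t, -, rfl⟩
    exact F.γ_mem_frontier t

theorem exists_bound : ∃ V : NNReal, 0 < V ∧
    ∀ t ∈ Icc (0 : ℝ) 1, ‖F.ν t‖ ≤ V ∧ ‖deriv F.γ t‖ ≤ V := by
  have h1 := F.contDiff_γ.continuous_deriv (by simp)
  have h2 := F.contDiff_ν.continuous
  obtain ⟨A, hA⟩ := isCompact_Icc.exists_bound_of_continuousOn (h1.continuousOn (s := Icc 0 1))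
  obtain ⟨B, hB⟩ := isCompact_Icc.exists_bound_of_continuousOn (h2.continuousOn (s := Icc 0 1))
  refine ⟨Real.toNNReal (max A B) + 1, by positivity, fun t ht => ?_⟩
  have h3 : max A B ≤ Real.toNNReal (max A B) := Real.le_coe_toNNReal _
  push_cast
  constructor
  · linarith [hB t ht, le_max_right A B]
  · linarith [hA t ht, le_max_left A B]

theorem restrict_frontier_le {V : NNReal} (hV : ∀ t ∈ Icc (0 : ℝ) 1, ‖deriv F.γ t‖ ≤ V) :
    (μH[1] : Measure E2).restrict (frontier Ω) ≤
      V • Measure.map F.γ ((volume : Measure ℝ).restrict (Ioc 0 1)) := by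
  have hγ := F.contDiff_γ.continuous
  have hlip : LipschitzOnWith V F.γ (Icc 0 1) :=
    (convex_Icc 0 1).lipschitzOnWith_of_nnnorm_deriv_le
      (fun t _ => (F.hasDerivAt_γ t).differentiableAt) hV
  rw [Measure.le_iff]
  intro B hB
  have himage : B ∩ F.γ '' Ioc 0 1 = F.γ '' (F.γ ⁻¹' B ∩ Ioc 0 1) := by
    rw [inter_comm (F.γ ⁻¹' B), image_inter_preimage, inter_comm]
  rw [Measure.restrict_apply hB, F.frontier_eq_image_Ioc, himage, Measure.smul_apply,
    Measure.map_apply hγ.measurable hB, Measure.restrict_apply (hγ.measurable hB)]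
  have h := (hlip.mono (inter_subset_right.trans Ioc_subset_Icc_self :
    F.γ ⁻¹' B ∩ Ioc 0 1 ⊆ Icc 0 1)).hausdorffMeasure_image_le zero_le_one
  rwa [hausdorffMeasure_real, ENNReal.rpow_one] at h

theorem hausdorffMeasure_frontier_ne_top (F : BoundaryFrame Ω) : μH[1] (frontier Ω) ≠ ⊤ := by
  obtain ⟨V, -, hV⟩ := F.exists_bound
  have h := F.restrict_frontier_le (fun t ht => (hV t ht).2) univ
  rw [Measure.restrict_apply_univ, Measure.smul_apply,
    Measure.map_apply F.contDiff_γ.continuous.measurable MeasurableSet.univ] at h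
  refine ne_top_of_le_ne_top ?_ h
  simp [ENNReal.smul_def]

theorem integral_frontier_le {V : NNReal} (hV : ∀ t ∈ Icc (0 : ℝ) 1, ‖deriv F.γ t‖ ≤ V)
    {g : E2 → ℝ} (hg : Continuous g) (h0 : ∀ x, 0 ≤ g x) :
    ∫ x in frontier Ω, g x ∂(μH[1]) ≤ V * ∫ t in (0 : ℝ)..1, g (F.γ t) := by
  have hγ := F.contDiff_γ.continuous
  have hgi : Integrable g (Measure.map F.γ ((volume : Measure ℝ).restrict (Ioc 0 1))) := by
    rw [integrable_map_measure hg.aestronglyMeasurable hγ.aemeasurable]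
    exact ((hg.comp hγ).continuousOn.integrableOn_compact
      (isCompact_Icc (a := 0) (b := 1))).mono_set Ioc_subset_Icc_self
  have h := integral_mono_measure (F.restrict_frontier_le hV) (.of_forall h0)
    (hgi.smul_measure_nnreal)
  rwa [integral_smul_nnreal_measure, integral_map hγ.aemeasurable hg.aestronglyMeasurable,
    ← intervalIntegral.integral_of_le zero_le_one] at h

theorem nonempty_exteriorCollar {δ : ℝ} (hδ : 0 < δ) (ho : IsOpen Ω) (hb : IsBounded Ω)
    (hout : F.IsOutward δ) : Nonempty (ExteriorCollar Ω) := by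
  obtain ⟨δ₁, hδ₁, hinj⟩ := F.exists_isInjStrip
  obtain ⟨δ₂, hδ₂, m, hm, M, hM, hjac⟩ := F.exists_jac_bounds
  obtain ⟨V, hV0, hV⟩ := F.exists_bound
  obtain ⟨r, hr, hr0, hr1, hr2⟩ : ∃ r > 0, r < δ ∧ r < δ₁ ∧ r < δ₂ := by
    obtain ⟨r, h0, h⟩ := exists_between (lt_min hδ (lt_min hδ₁ hδ₂))
    simp only [lt_min_iff] at h
    exact ⟨r, h0, h⟩
  have hcoll : ∀ h ∈ Ioc 0 r, ∀ g : E2 → ℝ,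
      ∫ x in F.map '' (Ioc (0 : ℝ) 1 ×ˢ Ioc (0 : ℝ) h), g x =
        ∫ z in Ioc (0 : ℝ) 1 ×ˢ Ioc (0 : ℝ) h, |F.jac z| * g (F.map z) := fun h hh g =>
    F.setIntegral_image_map hinj (measurableSet_Ioc.prod measurableSet_Ioc)
      (prod_mono_right fun s hs => ⟨by linarith [hs.1], by linarith [hs.2, hh.2]⟩) g
  have hbd : ∀ h ∈ Ioc 0 r, ∀ z ∈ Ioc (0 : ℝ) 1 ×ˢ Ioc (0 : ℝ) h,
      m ≤ |F.jac z| ∧ |F.jac z| ≤ M := fun h hh z hz =>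
    hjac z.1 z.2 (by rw [abs_of_pos hz.2.1]; linarith [hz.2.2, hh.2])
  refine ⟨⟨F.map, F.ν, r, m, M, V, hr, hm, hM, hV0, F.continuous_map, F.contDiff_ν.continuous,
    fun t s => ?_, fun t ht => (hV t ht).1, fun g hg h0 hi => ?_, fun h hh => ?_,
    fun g hg h0 => ?_⟩⟩
  · simpa [map] using ((hasDerivAt_id s).smul_const (F.ν t)).const_add (F.γ t)
  · have hc := F.continuous_map
    have hj := F.continuous_jac
    calc m * ∫ z in Ioc (0 : ℝ) 1 ×ˢ Ioc (0 : ℝ) r, g (F.map z)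
        = ∫ z in Ioc (0 : ℝ) 1 ×ˢ Ioc (0 : ℝ) r, m * g (F.map z) := by
          rw [integral_const_mul]
      _ ≤ ∫ z in Ioc (0 : ℝ) 1 ×ˢ Ioc (0 : ℝ) r, |F.jac z| * g (F.map z) := by
          refine setIntegral_mono_on (integrableOn_Ioc_prod_Ioc (by fun_prop) _ _ _ _)
            (integrableOn_Ioc_prod_Ioc (by fun_prop) _ _ _ _)
            (measurableSet_Ioc.prod measurableSet_Ioc) fun z hz => ?_
          exact mul_le_mul_of_nonneg_right (hbd r ⟨hr, le_rfl⟩ z hz).1 (h0 _)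
      _ = ∫ x in F.map '' (Ioc (0 : ℝ) 1 ×ˢ Ioc (0 : ℝ) r), g x :=
          (hcoll r ⟨hr, le_rfl⟩ g).symm
      _ ≤ ∫ x in extDom Ω, g x := by
          refine setIntegral_mono_set hi.integrableOn (.of_forall h0)
            (LE.le.eventuallyLE ?_)
          rintro _ ⟨⟨t, s⟩, ⟨-, hs⟩, rfl⟩
          exact hout.1 t s ⟨hs.1, hs.2.trans_lt hr0⟩
  · have hc := F.continuous_map
    have hj := F.continuous_jac
    refine ⟨Ω ∪ F.strip h, ho.union (F.isOpen_strip fun t s hs hz => ?_),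
      hb.union (F.isBounded_strip h), ?_, fun g hg h0 hi => ?_⟩
    · have := (hjac t s (by linarith [hh.2])).1
      rw [hz, abs_zero] at this
      linarith
    · rw [closure_eq_self_union_frontier]
      exact union_subset_union_right _ (F.frontier_subset_strip hh.1)
    · calc ∫ x in extDom Ω ∩ (Ω ∪ F.strip h), g x
          ≤ ∫ x in F.map '' (Ioc (0 : ℝ) 1 ×ˢ Ioc (0 : ℝ) h), g x := by
            refine setIntegral_mono_set hi.integrableOn (.of_forall h0)
              (LE.le.eventuallyLE ?_)
            rintro _ ⟨hx, hx' | ⟨⟨t, s⟩, ⟨-, hs⟩, rfl⟩⟩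
            · exact absurd (subset_closure hx') hx
            rcases lt_trichotomy s 0 with h1 | rfl | h1
            · exact absurd (subset_closure (hout.2 t s ⟨by linarith [hs.1, hh.2], h1⟩)) hx
            · rw [F.map_zero] at hx
              exact absurd (frontier_subset_closure (F.γ_mem_frontier t)) hx
            · obtain ⟨t', ht', h'⟩ := F.exists_map_Ioc t s
              exact ⟨(t', s), ⟨ht', h1, hs.2.le⟩, h'⟩
        _ = ∫ z in Ioc (0 : ℝ) 1 ×ˢ Ioc (0 : ℝ) h, |F.jac z| * g (F.map z) := hcoll h hh g
        _ ≤ ∫ z in Ioc (0 : ℝ) 1 ×ˢ Ioc (0 : ℝ) h, M * g (F.map z) := by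
            refine setIntegral_mono_on (integrableOn_Ioc_prod_Ioc (by fun_prop) _ _ _ _)
              (integrableOn_Ioc_prod_Ioc (by fun_prop) _ _ _ _)
              (measurableSet_Ioc.prod measurableSet_Ioc) fun z hz => ?_
            exact mul_le_mul_of_nonneg_right (hbd h hh z hz).2 (h0 _)
        _ = M * ∫ z in Ioc (0 : ℝ) 1 ×ˢ Ioc (0 : ℝ) h, g (F.map z) := by
            rw [integral_const_mul]
  · simpa only [map_zero] using F.integral_frontier_le (fun t ht => (hV t ht).2) hg h0

end BoundaryFrame

theorem HasSmoothBoundary.nonempty_boundaryFrame {Ω : Set E2} (h : HasSmoothBoundary Ω) :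
    Nonempty (BoundaryFrame Ω) := by
  obtain ⟨γ, hγ, hper, hne, hinj, hrange⟩ := h
  have hp : Function.Periodic γ 1 := hper
  have hfract : ∀ t, γ (Int.fract t) = γ t := fun t => by
    have h := hp.sub_int_mul_eq ⌊t⌋ (x := t)
    rwa [mul_one] at h
  have hd : ContDiff ℝ (⊤ : ℕ∞) (deriv γ) := (contDiff_infty_iff_deriv.1 hγ).2
  have hdi : ∀ i, ContDiff ℝ (⊤ : ℕ∞) fun t => deriv γ t i := contDiff_euclidean.1 hd
  have hdper : ∀ t, deriv γ (t + 1) = deriv γ t := fun t => by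
    rw [← deriv_comp_add_const]
    exact congrArg (fun f => deriv f t) (funext hper)
  refine ⟨⟨γ, fun t => !₂[-(deriv γ t 1), deriv γ t 0], hγ, ?_, hper, fun t => by rw [hdper],
    hrange, fun t t' htt' => ?_, fun t h0 => hne t ?_⟩⟩
  · rw [contDiff_euclidean]
    intro i
    fin_cases i
    · exact (hdi 1).neg
    · exact hdi 0
  · have := hinj ⟨Int.fract_nonneg t, Int.fract_lt_one t⟩
      ⟨Int.fract_nonneg t', Int.fract_lt_one t'⟩ (by rw [hfract, hfract, htt'])
    obtain ⟨z, hz⟩ := Int.fract_eq_fract.1 this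
    exact ⟨-z, by push_cast; linarith⟩
  · have h0' : deriv γ t 0 * deriv γ t 0 + deriv γ t 1 * deriv γ t 1 = 0 := by
      simpa using h0
    obtain ⟨h1, h2⟩ := mul_self_add_mul_self_eq_zero.1 h0'
    ext i
    fin_cases i
    · exact h1
    · exact h2

/-- The lowest Robin eigenvalue of the exterior is strictly increasing and strictly
concave as a function of the coupling constant on `(-∞, 0)`. -/
theorem robinEig_strictMonoOn_strictConcaveOn
    (Ω : Set E2) (hne : Ω.Nonempty) (ho : IsOpen Ω) (hb : IsBounded Ω)
    (hsm : HasSmoothBoundary Ω) (hconn : IsConnected (extDom Ω))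
    (hper : 0 < μH[1] (frontier Ω)) :
    StrictMonoOn (fun α => robinEig α Ω) (Iio 0) ∧
    StrictConcaveOn ℝ (Iio 0) (fun α => robinEig α Ω) := by
  obtain ⟨F⟩ := hsm.nonempty_boundaryFrame
  obtain ⟨c⟩ : Nonempty (ExteriorCollar Ω) := by
    obtain ⟨δ, hδ, h | h⟩ := F.exists_isOutward_or_neg ho hne hconn.nonempty
    · exact F.nonempty_exteriorCollar hδ ho hb h
    · exact F.neg.nonempty_exteriorCollar hδ ho hb h
  have hN := hasNegativeForm hb hconn.nonempty hper F.hausdorffMeasure_frontier_ne_top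
  exact ⟨robinEig_strictMonoOn c.traceEstimate hN,
    robinEig_strictConcaveOn c.traceEstimate c.nonConcentration hN⟩

end
end

section
/- Eigenvalue bounds for the exterior of a disk (Proposition 3.1, eigenvalue form): Let α < 0 and R > 0, and let B_R ⊂ ℝ² be an open disk of radius R. Then −α² < λ₁^α(B_R^ext) < −α² − α/R. -/
open MeasureTheory Metric Set Bornology Real Filter

noncomputable section

/-- The point of the unit circle with angle `θ`. -/
def unitVec (θ : ℝ) : E2 := !₂[cos θ, sin θ]

lemma norm_unitVec (θ : ℝ) : ‖unitVec θ‖ = 1 := by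
  simp [unitVec, EuclideanSpace.norm_eq]

lemma contDiff_unitVec : ContDiff ℝ (⊤ : ℕ∞) unitVec := by
  unfold unitVec
  rw [contDiff_euclidean]
  intro i
  fin_cases i
  · exact Real.contDiff_cos
  · exact Real.contDiff_sin

lemma dist_unitVec_le (s t : ℝ) : dist (unitVec s) (unitVec t) ≤ dist s t := by
  rw [EuclideanSpace.dist_eq, Real.dist_eq, ← Real.sqrt_sq_eq_abs]
  apply Real.sqrt_le_sqrt
  have := Real.one_sub_sq_div_two_le_cos (x := s - t)
  rw [Real.cos_sub] at this
  simp only [unitVec, Real.dist_eq, sq_abs, Fin.sum_univ_two, PiLp.toLp_apply, Matrix.cons_val_zero,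
    Matrix.cons_val_one]
  nlinarith [Real.sin_sq_add_cos_sq s, Real.sin_sq_add_cos_sq t]

lemma injOn_unitVec : InjOn unitVec (Ioc (-π) π) := by
  intro s hs t ht h
  have h0 : cos s = cos t := by simpa [unitVec] using congrArg (fun v : E2 => v 0) h
  have h1 : sin s = sin t := by simpa [unitVec] using congrArg (fun v : E2 => v 1) h
  rw [← Complex.arg_cos_add_sin_mul_I hs, ← Complex.arg_cos_add_sin_mul_I ht]
  norm_cast
  rw [h0, h1]

lemma exists_unitVec_eq {v : E2} (hv : ‖v‖ = 1) : ∃ θ ∈ Ioc (-π) π, unitVec θ = v := by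
  set z : ℂ := ⟨v 0, v 1⟩ with hz
  have hn : ‖z‖ = 1 := by
    rw [← hv, EuclideanSpace.norm_eq, Complex.norm_def, Complex.normSq_apply]
    simp [hz, sq]
  have h0 : z ≠ 0 := by
    intro h; simp [h] at hn
  refine ⟨z.arg, Complex.arg_mem_Ioc z, ?_⟩
  ext i
  fin_cases i
  · simpa [unitVec, hn] using Complex.cos_arg h0
  · simpa [unitVec, hn] using Complex.sin_arg z

lemma extDom_ball (c : E2) {R : ℝ} (hR : 0 < R) : extDom (ball c R) = (closedBall c R)ᶜ := by
  rw [extDom, closure_ball _ hR.ne']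

lemma setIntegral_extDom_ball (c : E2) {R : ℝ} (hR : 0 < R) (G : E2 → ℝ) :
    ∫ x in extDom (ball c R), G x =
      ∫ p in Ioi R ×ˢ Ioo (-π) π, p.1 * G (c + p.1 • unitVec p.2) := by
  have hm : MeasurableSet (closedBall c R)ᶜ := isClosed_closedBall.measurableSet.compl
  let F : E2 → ℝ := fun x => (closedBall c R)ᶜ.indicator G (c + x)
  let T : E2 ≃ᵐ ℝ × ℝ := (MeasurableEquiv.toLp 2 (Fin 2 → ℝ)).symm.trans MeasurableEquiv.finTwoArrow
  have hT : MeasurePreserving T :=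
    (EuclideanSpace.volume_preserving_symm_measurableEquiv_toLp (Fin 2)).trans
      (volume_preserving_finTwoArrow ℝ)
  rw [extDom_ball c hR, ← integral_indicator hm, ← integral_add_left_eq_self _ c]
  have h1 : ∫ x, F x = ∫ p, F (T.symm p) :=
    ((hT.symm T).integral_comp T.symm.measurableEmbedding F).symm
  refine h1.trans ?_
  rw [← integral_comp_polarCoord_symm, polarCoord_target]
  have h2 : ∀ p ∈ Ioi (0 : ℝ) ×ˢ Ioo (-π) π, p.1 • F (T.symm (polarCoord.symm p)) =
      (Ioi R ×ˢ Ioo (-π) π).indicator (fun p => p.1 * G (c + p.1 • unitVec p.2)) p := by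
    rintro ⟨r, θ⟩ ⟨hr, hθ⟩
    have h3 : T.symm (polarCoord.symm (r, θ)) = r • unitVec θ := by
      ext i
      fin_cases i <;> simp [T, unitVec, polarCoord]
    rw [h3]
    simp only [mem_Ioi] at hr
    by_cases h : R < r
    · rw [indicator_of_mem (show (r, θ) ∈ Ioi R ×ˢ Ioo (-π) π from ⟨h, hθ⟩)]
      simp only [F, smul_eq_mul]
      rw [indicator_of_mem]
      simpa [norm_smul, norm_unitVec, abs_of_pos hr] using h
    · rw [indicator_of_notMem (show (r, θ) ∉ Ioi R ×ˢ Ioo (-π) π from fun h' => h h'.1)]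
      simp only [F, smul_eq_mul]
      rw [indicator_of_notMem, mul_zero]
      simpa [norm_smul, norm_unitVec, abs_of_pos hr] using h
  rw [setIntegral_congr_fun (measurableSet_Ioi.prod measurableSet_Ioo) h2,
    setIntegral_indicator (measurableSet_Ioi.prod measurableSet_Ioo), inter_eq_right.2]
  exact prod_mono (Ioi_subset_Ioi hR.le) subset_rfl

lemma lipschitzWith_circle (c : E2) {R : ℝ} (hR : 0 < R) :
    LipschitzWith R.toNNReal (fun θ => c + R • unitVec θ) := by
  refine LipschitzWith.of_dist_le_mul fun s t => ?_
  rw [dist_add_left, dist_smul₀, Real.norm_of_nonneg hR.le, Real.coe_toNNReal _ hR.le]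
  exact mul_le_mul_of_nonneg_left (dist_unitVec_le s t) hR.le

lemma injOn_circle (c : E2) {R : ℝ} (hR : 0 < R) :
    InjOn (fun θ => c + R • unitVec θ) (Ioc (-π) π) := fun _ hs _ ht h =>
  injOn_unitVec hs ht (smul_right_injective E2 hR.ne' (add_left_cancel h))

lemma image_circle (c : E2) {R : ℝ} (hR : 0 < R) :
    (fun θ => c + R • unitVec θ) '' Ioc (-π) π = sphere c R := by
  ext x
  constructor
  · rintro ⟨θ, -, rfl⟩
    simp [norm_smul, norm_unitVec, abs_of_pos hR]
  · intro hx
    obtain ⟨θ, hθ, h⟩ := exists_unitVec_eq (v := R⁻¹ • (x - c)) (by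
      rw [norm_smul, ← dist_eq_norm, mem_sphere.1 hx, norm_inv, Real.norm_of_nonneg hR.le,
        inv_mul_cancel₀ hR.ne'])
    exact ⟨θ, hθ, by simp [h, smul_smul, hR.ne']⟩

/-- Projecting an arc onto its midpoint tangent bounds its length below by that of its chord. -/
lemma le_hausdorffMeasure_arc (c : E2) (R m : ℝ) {h : ℝ} (h0 : 0 < h) :
    ENNReal.ofReal (2 * (R * sin h)) ≤
      μH[1] ((fun θ => c + R • unitVec θ) '' Ioo (m - h) (m + h)) := by
  let τ : E2 := unitVec (m + π / 2)
  let ℓ : E2 → ℝ := fun x => inner ℝ τ (x - c)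
  have hℓ : LipschitzWith 1 ℓ := by
    refine LipschitzWith.of_dist_le_mul fun x y => ?_
    simp only [ℓ, Real.dist_eq, ← inner_sub_right, sub_sub_sub_cancel_right, NNReal.coe_one]
    refine (abs_real_inner_le_norm _ _).trans ?_
    rw [norm_unitVec, dist_eq_norm]
  have hval : ∀ θ, ℓ (c + R • unitVec θ) = R * sin (θ - m) := by
    intro θ
    simp only [ℓ, τ, add_sub_cancel_left, inner_smul_right, sin_sub]
    simp [unitVec, PiLp.inner_apply, Fin.sum_univ_two, Real.cos_add_pi_div_two,
      Real.sin_add_pi_div_two]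
    left; ring
  have hsub : Ioo (-(R * sin h)) (R * sin h) ⊆
      ℓ '' ((fun θ => c + R • unitVec θ) '' Ioo (m - h) (m + h)) := by
    rw [image_image]
    simp only [hval]
    have := intermediate_value_Ioo (a := m - h) (b := m + h) (by linarith)
      (f := fun θ => R * sin (θ - m)) (by fun_prop)
    simpa [sub_sub_cancel_left] using this
  calc ENNReal.ofReal (2 * (R * sin h)) = volume (Ioo (-(R * sin h)) (R * sin h)) := by
        rw [Real.volume_Ioo]; congr 1; ring
    _ ≤ μH[1] (ℓ '' ((fun θ => c + R • unitVec θ) '' Ioo (m - h) (m + h))) := by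
        rw [hausdorffMeasure_real]; exact measure_mono hsub
    _ ≤ _ := by simpa using hℓ.hausdorffMeasure_image_le zero_le_one _

lemma ofReal_inscribed_polygon_le_hausdorffMeasure (c : E2) {R : ℝ} (hR : 0 < R) {n : ℕ} (hn : 0 < n) :
    ENNReal.ofReal (n * (2 * (R * sin (π / n)))) ≤ μH[1] (sphere c R) := by
  have hn' : (0 : ℝ) < n := by exact_mod_cast hn
  have hh : 0 < π / n := div_pos pi_pos hn'
  let m : ℕ → ℝ := fun k => -π + (2 * k + 1) * (π / n)
  let A : ℕ → Set ℝ := fun k => Ioo (m k - π / n) (m k + π / n)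
  have hπ : π = n * (π / n) := by field_simp
  have hA : ∀ k ∈ Finset.range n, A k ⊆ Ioc (-π) π := by
    intro k hk x hx
    have hk' : (k : ℝ) + 1 ≤ n := by exact_mod_cast Finset.mem_range.1 hk
    have hk0 : (0 : ℝ) ≤ k := k.cast_nonneg
    simp only [A, m, mem_Ioo] at hx
    constructor
    · nlinarith
    · nlinarith
  have hdA : ∀ i j : ℕ, i < j → Disjoint (A i) (A j) := by
    intro i j hij
    rw [Set.disjoint_left]
    intro x hx hy
    have hij' : (i : ℝ) + 1 ≤ j := by exact_mod_cast hij
    simp only [A, m, mem_Ioo] at hx hy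
    nlinarith
  have hdis : (Finset.range n : Set ℕ).PairwiseDisjoint
      (fun k => (fun θ => c + R • unitVec θ) '' A k) := by
    intro i hi j hj hij
    refine Disjoint.image ?_ (injOn_circle c hR) (hA i hi) (hA j hj)
    rcases hij.lt_or_gt with h | h
    exacts [hdA i j h, (hdA j i h).symm]
  have hmeas : ∀ k ∈ Finset.range n,
      MeasurableSet ((fun θ => c + R • unitVec θ) '' A k) := fun k hk =>
    measurableSet_Ioo.image_of_continuousOn_injOn
      (lipschitzWith_circle c hR).continuous.continuousOn ((injOn_circle c hR).mono (hA k hk))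
  calc ENNReal.ofReal (n * (2 * (R * sin (π / n))))
      = ∑ k ∈ Finset.range n, ENNReal.ofReal (2 * (R * sin (π / n))) := by
        rw [Finset.sum_const, Finset.card_range, nsmul_eq_mul, ENNReal.ofReal_mul hn'.le,
          ENNReal.ofReal_natCast]
    _ ≤ ∑ k ∈ Finset.range n, μH[1] ((fun θ => c + R • unitVec θ) '' A k) :=
        Finset.sum_le_sum fun k _ => le_hausdorffMeasure_arc c R _ hh
    _ = μH[1] (⋃ k ∈ Finset.range n, (fun θ => c + R • unitVec θ) '' A k) :=
        (measure_biUnion_finset hdis hmeas).symm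
    _ ≤ μH[1] (sphere c R) := by
        refine measure_mono (iUnion₂_subset fun k hk => ?_)
        rw [← image_circle c hR]
        exact image_mono (hA k hk)

lemma le_hausdorffMeasure_sphere (c : E2) {R : ℝ} (hR : 0 < R) :
    ENNReal.ofReal (R * (2 * π)) ≤ μH[1] (sphere c R) := by
  have hlim : Tendsto (fun n : ℕ => (n : ℝ) * (2 * (R * sin (π / n)))) atTop
      (nhds (R * (2 * π))) := by
    have h1 : Tendsto (fun n : ℕ => sinc (π / n)) atTop (nhds (sinc 0)) :=
      (continuous_sinc.tendsto 0).comp (tendsto_const_div_atTop_nhds_zero_nat π)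
    rw [sinc_zero] at h1
    have h2 := h1.const_mul (R * (2 * π))
    rw [mul_one] at h2
    refine h2.congr' ?_
    filter_upwards [eventually_gt_atTop 0] with n hn
    have hn' : (0 : ℝ) < n := by exact_mod_cast hn
    rw [sinc_of_ne_zero (by positivity)]
    field_simp
  refine le_of_tendsto ((ENNReal.continuous_ofReal.tendsto _).comp hlim) ?_
  filter_upwards [eventually_gt_atTop 0] with n hn
  exact ofReal_inscribed_polygon_le_hausdorffMeasure c hR hn

lemma hausdorffMeasure_restrict_sphere (c : E2) {R : ℝ} (hR : 0 < R) :
    (μH[1] : Measure E2).restrict (sphere c R) =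
      ENNReal.ofReal R •
        (volume.restrict (Ioc (-π) π)).map (fun θ => c + R • unitVec θ) := by
  have hmeas : Measurable (fun θ => c + R • unitVec θ) :=
    (lipschitzWith_circle c hR).continuous.measurable
  have hle : (μH[1] : Measure E2).restrict (sphere c R) ≤ ENNReal.ofReal R •
      (volume.restrict (Ioc (-π) π)).map (fun θ => c + R • unitVec θ) := by
    refine Measure.le_iff.2 fun S hS => ?_
    rw [Measure.restrict_apply hS, Measure.smul_apply, Measure.map_apply hmeas hS,
      Measure.restrict_apply (hmeas hS), ← image_circle c hR, inter_comm,
      ← image_inter_preimage, inter_comm _ (Ioc (-π) π), ← hausdorffMeasure_real]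
    simpa [ENNReal.ofReal] using ((lipschitzWith_circle c hR).hausdorffMeasure_image_le zero_le_one _)
  have hfin : IsFiniteMeasure (ENNReal.ofReal R •
      (volume.restrict (Ioc (-π) π)).map (fun θ => c + R • unitVec θ)) :=
    Measure.smul_finite _ ENNReal.ofReal_ne_top
  have := isFiniteMeasure_of_le _ hle
  refine Measure.eq_of_le_of_measure_univ_eq hle (le_antisymm (hle _) ?_)
  rw [Measure.restrict_apply_univ, Measure.smul_apply, Measure.map_apply hmeas MeasurableSet.univ,
    preimage_univ, Measure.restrict_apply_univ, Real.volume_Ioc, smul_eq_mul,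
    ← ENNReal.ofReal_mul hR.le, sub_neg_eq_add, ← two_mul]
  exact le_hausdorffMeasure_sphere c hR

lemma setIntegral_sphere (c : E2) {R : ℝ} (hR : 0 < R) {f : E2 → ℝ} (hf : Continuous f) :
    ∫ x in sphere c R, f x ∂μH[1] = R * ∫ θ in Ioo (-π) π, f (c + R • unitVec θ) := by
  rw [hausdorffMeasure_restrict_sphere c hR, integral_smul_measure, integral_map
    (lipschitzWith_circle c hR).continuous.aemeasurable hf.aestronglyMeasurable,
    ENNReal.toReal_ofReal hR.le, smul_eq_mul, integral_Ioc_eq_integral_Ioo]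

lemma integrableOn_Ioi_prod_Ioo {H : ℝ × ℝ → ℝ} (hH : Continuous H) {M : ℝ}
    (hM : ∀ r θ, M < r → H (r, θ) = 0) (R : ℝ) :
    IntegrableOn H (Ioi R ×ˢ Ioo (-π) π) := by
  have h1 : IntegrableOn H (Icc R M ×ˢ Icc (-π) π) :=
    hH.continuousOn.integrableOn_compact (isCompact_Icc.prod isCompact_Icc)
  refine h1.of_forall_sdiff_eq_zero (measurableSet_Ioi.prod measurableSet_Ioo) ?_
  rintro ⟨r, θ⟩ ⟨⟨hr, hθ⟩, h⟩
  refine hM r θ (not_le.1 fun hle => h ⟨⟨le_of_lt hr, hle⟩, Ioo_subset_Icc_self hθ⟩)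

lemma exists_radius_vanish {u : E2 → ℝ} (hc : HasCompactSupport u) (c : E2) :
    ∃ M : ℝ, 0 < M ∧ ∀ r θ : ℝ, M < r → u (c + r • unitVec θ) = 0 ∧
      fderiv ℝ u (c + r • unitVec θ) = 0 := by
  obtain ⟨M, hM0, hM⟩ := hc.isCompact.isBounded.subset_ball_lt 0 c
  refine ⟨M, hM0, fun r θ hr => ?_⟩
  have hx : c + r • unitVec θ ∉ tsupport u := fun h => by
    have := hM h
    simp [norm_smul, norm_unitVec, abs_of_pos (hM0.trans hr)] at this
    linarith
  exact ⟨image_eq_zero_of_notMem_tsupport hx,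
    image_eq_zero_of_notMem_tsupport fun h => hx (tsupport_fderiv_subset ℝ h)⟩

/-- The gap above `-a ^ 2` in the lower bound for the exterior of a disk. -/
def robinGap (a R : ℝ) : ℝ := min (3 * a ^ 2 / 4) (a / (2 * R))

lemma riccati_le {a R r : ℝ} (ha : 0 < a) (hR : 0 < R) (hr : R < r) :
    (a / 2 * (r + R)) ^ 2 - a / 2 * r ≤ (a ^ 2 - robinGap a R) * r ^ 2 := by
  have h1 : robinGap a R ≤ 3 * a ^ 2 / 4 := min_le_left _ _
  have h2 : robinGap a R * R ≤ a / 2 := by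
    calc robinGap a R * R ≤ a / (2 * R) * R := by gcongr; exact min_le_right _ _
      _ = a / 2 := by field_simp
  have h3 := mul_le_mul_of_nonneg_right h1
    (mul_pos (hR.trans hr) (sub_pos.2 hr)).le
  have h4 := mul_le_mul_of_nonneg_right h2 (hR.trans hr).le
  nlinarith [mul_nonneg (mul_pos ha ha).le (mul_pos hR (sub_pos.2 hr)).le]

lemma robin_form_lower {a R : ℝ} (ha : 0 < a) (hR : 0 < R) (c : E2) {u : E2 → ℝ}
    (hu : ContDiff ℝ (⊤ : ℕ∞) u) (hc : HasCompactSupport u) :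
    a * (∫ x in sphere c R, u x ^ 2 ∂μH[1]) -
        (a ^ 2 - robinGap a R) * ∫ x in extDom (ball c R), u x ^ 2 ≤
      ∫ x in extDom (ball c R), ‖fderiv ℝ u x‖ ^ 2 := by
  obtain ⟨M, hM0, hM⟩ := exists_radius_vanish hc c
  have hcu := hu.continuous
  have hcf : Continuous (fderiv ℝ u) := hu.continuous_fderiv (by simp)
  have hce := contDiff_unitVec.continuous
  let F' : ℝ × ℝ → ℝ := fun p => -(a / 2) * u (c + p.1 • unitVec p.2) ^ 2 +
    -(a / 2) * (p.1 + R) * (2 * u (c + p.1 • unitVec p.2) *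
      fderiv ℝ u (c + p.1 • unitVec p.2) (unitVec p.2))
  have hF'i : IntegrableOn F' (Ioi R ×ˢ Ioo (-π) π) := by
    refine integrableOn_Ioi_prod_Ioo (by fun_prop) (M := M) (fun r θ hr => ?_) R
    simp [F', hM r θ hr]
  have hUi : IntegrableOn (fun p : ℝ × ℝ => p.1 * u (c + p.1 • unitVec p.2) ^ 2)
      (Ioi R ×ˢ Ioo (-π) π) := by
    refine integrableOn_Ioi_prod_Ioo (by fun_prop) (M := M) (fun r θ hr => ?_) R
    simp [hM r θ hr]
  have hDi : IntegrableOn (fun p : ℝ × ℝ => p.1 * ‖fderiv ℝ u (c + p.1 • unitVec p.2)‖ ^ 2)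
      (Ioi R ×ˢ Ioo (-π) π) := by
    refine integrableOn_Ioi_prod_Ioo (by fun_prop) (M := M) (fun r θ hr => ?_) R
    simp [hM r θ hr]
  have hray : ∀ θ, ∫ r in Ioi R, F' (r, θ) = a * R * u (c + R • unitVec θ) ^ 2 := by
    intro θ
    have hd : ∀ r ∈ Ici R, HasDerivAt
        (fun r => -(a / 2) * (r + R) * u (c + r • unitVec θ) ^ 2) (F' (r, θ)) r := by
      intro r _
      have h1 : HasDerivAt (fun r : ℝ => c + r • unitVec θ) (unitVec θ) r := by
        simpa using ((hasDerivAt_id r).smul_const (unitVec θ)).const_add c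
      have h2 : HasDerivAt (fun r : ℝ => u (c + r • unitVec θ))
          (fderiv ℝ u (c + r • unitVec θ) (unitVec θ)) r :=
        (hu.differentiable (by simp) _).hasFDerivAt.comp_hasDerivAt r h1
      have h3 : HasDerivAt (fun r : ℝ => -(a / 2) * (r + R)) (-(a / 2)) r := by
        simpa using ((hasDerivAt_id r).add_const R).const_mul (-(a / 2))
      refine (h3.mul (h2.pow 2)).congr_deriv ?_
      simp [F']
    have hInt : IntegrableOn (fun r => F' (r, θ)) (Ioi R) := by
      have hcont : Continuous fun r => F' (r, θ) := by fun_prop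
      refine (hcont.continuousOn.integrableOn_compact (isCompact_Icc (a := R) (b := M))
        |>.of_forall_sdiff_eq_zero measurableSet_Ioi ?_)
      rintro r ⟨hr, h⟩
      have : M < r := not_le.1 fun hle => h ⟨le_of_lt hr, hle⟩
      simp [F', hM r θ this]
    have hlim : Tendsto (fun r => -(a / 2) * (r + R) * u (c + r • unitVec θ) ^ 2) atTop
        (nhds 0) := by
      refine tendsto_const_nhds.congr' ?_
      filter_upwards [eventually_gt_atTop M] with r hr
      simp [hM r θ hr]
    rw [integral_Ioi_of_hasDerivAt_of_tendsto' hd hInt hlim]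
    ring
  have hFint : ∫ p in Ioi R ×ˢ Ioo (-π) π, F' p = a * ∫ x in sphere c R, u x ^ 2 ∂μH[1] := by
    rw [setIntegral_sphere c hR (f := fun x => u x ^ 2) (hcu.pow 2), Measure.volume_eq_prod,
      ← Measure.prod_restrict, integral_prod_symm]
    · simp only [hray]
      rw [integral_const_mul, mul_assoc]
    · rwa [Measure.prod_restrict, ← Measure.volume_eq_prod]
  rw [setIntegral_extDom_ball c hR, setIntegral_extDom_ball c hR, ← hFint, ← integral_const_mul,
    ← integral_sub hF'i (hUi.const_mul _)]
  refine setIntegral_mono_on (hF'i.sub (hUi.const_mul _)) hDi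
    (measurableSet_Ioi.prod measurableSet_Ioo) ?_
  rintro ⟨r, θ⟩ ⟨hr, -⟩
  have hr0 : 0 < r := hR.trans hr
  have hle : |fderiv ℝ u (c + r • unitVec θ) (unitVec θ)| ≤ ‖fderiv ℝ u (c + r • unitVec θ)‖ := by
    simpa [norm_unitVec] using (fderiv ℝ u (c + r • unitVec θ)).le_opNorm (unitVec θ)
  have hsq := sq_le_sq' (abs_le.1 hle).1 (abs_le.1 hle).2
  have hric := riccati_le ha hR hr
  simp only [F']
  generalize fderiv ℝ u (c + r • unitVec θ) (unitVec θ) = d at *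
  generalize ‖fderiv ℝ u (c + r • unitVec θ)‖ = D at *
  generalize u (c + r • unitVec θ) = g at *
  refine le_of_mul_le_mul_left ?_ hr0
  have h1 := mul_le_mul_of_nonneg_right hric (sq_nonneg g)
  have h2 := mul_le_mul_of_nonneg_left hsq (sq_nonneg r)
  nlinarith [sq_nonneg (r * d + a / 2 * (r + R) * g)]

lemma contDiff_comp_dist (c : E2) {w : ℝ → ℝ} (hw : ContDiff ℝ (⊤ : ℕ∞) w) {ρ : ℝ} (hρ : 0 < ρ)
    (hw0 : ∀ r < ρ, w r = 0) : ContDiff ℝ (⊤ : ℕ∞) (fun x : E2 => w ‖x - c‖) := by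
  refine contDiff_iff_contDiffAt.2 fun x => ?_
  rcases eq_or_ne x c with rfl | hx
  · refine contDiffAt_const (c := (0 : ℝ)) |>.congr_of_eventuallyEq ?_
    filter_upwards [ball_mem_nhds x hρ] with y hy
    exact hw0 _ (by rwa [← dist_eq_norm])
  · exact hw.contDiffAt.comp x
      ((contDiffAt_norm ℝ (sub_ne_zero.2 hx)).comp x (contDiffAt_id.sub contDiffAt_const))

lemma norm_fderiv_comp_dist (c : E2) {w : ℝ → ℝ} (hw : Differentiable ℝ w) {x : E2} (hx : x ≠ c) :
    ‖fderiv ℝ (fun x : E2 => w ‖x - c‖) x‖ = |deriv w ‖x - c‖| := by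
  have hd : DifferentiableAt ℝ (‖·‖) (x - c) :=
    (contDiffAt_norm ℝ (n := 1) (sub_ne_zero.2 hx)).differentiableAt (by simp)
  have h1 : HasFDerivAt (fun x : E2 => ‖x - c‖) (fderiv ℝ (‖·‖) (x - c)) x := by
    simpa using! hd.hasFDerivAt.comp x ((hasFDerivAt_id x).sub_const c)
  have h2 := (hw ‖x - c‖).hasDerivAt.comp_hasFDerivAt x h1
  rw [HasFDerivAt.fderiv (f := fun x : E2 => w ‖x - c‖) h2, norm_smul,
    norm_fderiv_norm hd, mul_one, Real.norm_eq_abs]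

lemma setIntegral_extDom_ball_radial (c : E2) {R : ℝ} (hR : 0 < R) (f : ℝ → ℝ) :
    ∫ x in extDom (ball c R), f ‖x - c‖ = (∫ r in Ioi R, r * f r) * (2 * π) := by
  have h : ∀ p ∈ Ioi R ×ˢ Ioo (-π) π,
      p.1 * f ‖c + p.1 • unitVec p.2 - c‖ = (p.1 * f p.1) * (fun _ : ℝ => (1 : ℝ)) p.2 := by
    rintro ⟨r, θ⟩ ⟨hr, -⟩
    simp [norm_smul, norm_unitVec, abs_of_pos (hR.trans hr)]
  rw [setIntegral_extDom_ball c hR,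
    setIntegral_congr_fun (measurableSet_Ioi.prod measurableSet_Ioo) h, Measure.volume_eq_prod,
    setIntegral_prod_mul (fun r => r * f r) (fun _ => (1 : ℝ))]
  simp [pi_pos.le, two_mul]

/-- The Rayleigh quotients whose infimum is `robinEig α Ω`. -/
def robinQuotients (α : ℝ) (Ω : Set E2) : Set ℝ :=
  { q : ℝ | ∃ u : E2 → ℝ, ContDiff ℝ (⊤ : ℕ∞) u ∧ HasCompactSupport u ∧
    (∃ x ∈ extDom Ω, u x ≠ 0) ∧
    q = ((∫ x in extDom Ω, ‖fderiv ℝ u x‖ ^ 2) +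
          α * ∫ x in frontier Ω, (u x) ^ 2 ∂(μH[1])) /
        (∫ x in extDom Ω, (u x) ^ 2) }

lemma radial_mem_robinQuotients (α : ℝ) (c : E2) {R : ℝ} (hR : 0 < R) {w : ℝ → ℝ}
    (hw : ContDiff ℝ (⊤ : ℕ∞) w) {ρ : ℝ} (hρ : 0 < ρ) (hw0 : ∀ r < ρ, w r = 0) {M : ℝ}
    (hwM : ∀ r, M < r → w r = 0) (hne : ∃ r, R < r ∧ w r ≠ 0) :
    ((∫ r in Ioi R, r * deriv w r ^ 2) + α * (R * w R ^ 2)) / (∫ r in Ioi R, r * w r ^ 2) ∈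
      robinQuotients α (ball c R) := by
  refine ⟨fun x => w ‖x - c‖, contDiff_comp_dist c hw hρ hw0, ?_, ?_, ?_⟩
  · refine HasCompactSupport.intro (isCompact_closedBall c M) fun x hx => hwM _ ?_
    rw [← dist_eq_norm]
    simpa using hx
  · obtain ⟨r, hr, h⟩ := hne
    have hn : ‖c + r • unitVec 0 - c‖ = r := by
      simp [norm_smul, norm_unitVec, abs_of_pos (hR.trans hr)]
    refine ⟨c + r • unitVec 0, ?_, by simpa only [hn] using h⟩
    rw [extDom_ball c hR, mem_compl_iff, mem_closedBall, dist_eq_norm, hn]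
    exact not_le.2 hr
  · have h1 : ∫ x in extDom (ball c R), ‖fderiv ℝ (fun x : E2 => w ‖x - c‖) x‖ ^ 2 =
        (∫ r in Ioi R, r * deriv w r ^ 2) * (2 * π) := by
      rw [← setIntegral_extDom_ball_radial c hR (fun r => deriv w r ^ 2)]
      refine setIntegral_congr_fun isClosed_closure.measurableSet.compl fun x hx => ?_
      have hxc : x ≠ c := by
        rintro rfl
        exact hx (subset_closure (mem_ball_self hR))
      simp only [norm_fderiv_comp_dist c (hw.differentiable (by simp)) hxc, sq_abs]
    have h2 : ∫ x in frontier (ball c R), w ‖x - c‖ ^ 2 ∂μH[1] = R * w R ^ 2 * (2 * π) := by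
      rw [frontier_ball c hR.ne', setIntegral_sphere c hR (f := fun x => w ‖x - c‖ ^ 2)
        ((hw.continuous.comp (by fun_prop)).pow 2)]
      simp [norm_smul, norm_unitVec, abs_of_pos hR, pi_pos.le, ← two_mul]
      ring
    rw [h1, h2, setIntegral_extDom_ball_radial c hR (fun r => w r ^ 2), ← mul_assoc α (R * _),
      ← add_mul, mul_div_mul_right _ _ two_pi_pos.ne']

lemma exists_bound_deriv_smoothTransition : ∃ C, ∀ x, |deriv smoothTransition x| ≤ C := by
  have hcont : Continuous (deriv smoothTransition) :=
    (smoothTransition.contDiff (n := 1)).continuous_deriv le_rfl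
  have hsupp : HasCompactSupport (deriv smoothTransition) := by
    refine HasCompactSupport.intro (isCompact_Icc (a := (0 : ℝ)) (b := 1)) fun x hx => ?_
    rw [mem_Icc, not_and_or, not_le, not_le] at hx
    rcases hx with hx | hx
    · rw [Filter.EventuallyEq.deriv_eq (f := fun _ => 0), deriv_const]
      filter_upwards [Iio_mem_nhds hx] with y hy using smoothTransition.zero_of_nonpos (le_of_lt hy)
    · rw [Filter.EventuallyEq.deriv_eq (f := fun _ => 1), deriv_const]
      filter_upwards [Ioi_mem_nhds hx] with y hy using smoothTransition.one_of_one_le (le_of_lt hy)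
  exact hcont.bounded_above_of_compact_support hsupp

lemma integral_Ioi_mul_exp {b R : ℝ} (hb : 0 < b) (hR : 0 < R) :
    IntegrableOn (fun r => r * exp (-b * r)) (Ioi R) ∧
      ∫ r in Ioi R, r * exp (-b * r) = exp (-b * R) * (R / b + 1 / b ^ 2) := by
  have hd : ∀ r ∈ Ici R, HasDerivAt (fun r => -(exp (-b * r) * (r / b + 1 / b ^ 2)))
      (r * exp (-b * r)) r := by
    intro r _
    have h1 : HasDerivAt (fun r => exp (-b * r)) (exp (-b * r) * (-b)) r := by
      simpa using ((hasDerivAt_id r).const_mul (-b)).exp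
    have h2 : HasDerivAt (fun r => r / b + 1 / b ^ 2) (1 / b) r :=
      ((hasDerivAt_id r).div_const b).add_const _
    refine (h1.mul h2).neg.congr_deriv ?_
    field_simp
    ring
  have hlim : Tendsto (fun r => -(exp (-b * r) * (r / b + 1 / b ^ 2))) atTop (nhds 0) := by
    have h1 := tendsto_rpow_mul_exp_neg_mul_atTop_nhds_zero 1 b hb
    have h0 := tendsto_rpow_mul_exp_neg_mul_atTop_nhds_zero 0 b hb
    simp only [rpow_one, rpow_zero, one_mul] at h1 h0
    have h := ((h1.div_const b).add (h0.div_const (b ^ 2))).neg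
    simp only [zero_div, add_zero, neg_zero] at h
    refine h.congr fun r => ?_
    ring
  have hpos : ∀ r ∈ Ioi R, 0 ≤ r * exp (-b * r) := fun r hr =>
    mul_nonneg (hR.trans hr).le (exp_pos _).le
  refine ⟨integrableOn_Ioi_deriv_of_nonneg' hd hpos hlim, ?_⟩
  rw [integral_Ioi_of_hasDerivAt_of_nonneg' hd hpos hlim]
  ring

/-- The exponential `exp (-a * r)`, smoothly cut off between `r = n` and `r = n + 1`. -/
def cutExp (a : ℝ) (n : ℕ) (r : ℝ) : ℝ := exp (-a * r) * smoothTransition (n + 1 - r)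

/-- The formula for the derivative of `cutExp a n`. -/
def cutExpDeriv (a : ℝ) (n : ℕ) (r : ℝ) : ℝ :=
  exp (-a * r) * (-a * smoothTransition (n + 1 - r) - deriv smoothTransition (n + 1 - r))

lemma hasDerivAt_cutExp (a : ℝ) (n : ℕ) (r : ℝ) :
    HasDerivAt (cutExp a n) (cutExpDeriv a n r) r := by
  have h1 : HasDerivAt (fun r => exp (-a * r)) (exp (-a * r) * (-a)) r := by
    simpa using ((hasDerivAt_id r).const_mul (-a)).exp
  have h2 : HasDerivAt (fun r => smoothTransition (n + 1 - r))
      (-deriv smoothTransition (n + 1 - r)) r := by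
    have h3 : HasDerivAt (fun r : ℝ => (n : ℝ) + 1 - r) (-1) r :=
      (hasDerivAt_id r).const_sub _
    have h4 := ((smoothTransition.contDiff (n := 1)).differentiable (by simp)
      (n + 1 - r)).hasDerivAt.comp r h3
    simpa using! h4
  refine (h1.mul h2).congr_deriv ?_
  simp only [cutExpDeriv]
  ring

lemma tendsto_integral_of_eventually_eq_exp {a R K : ℝ} (ha : 0 < a) (hR : 0 < R)
    {f : ℕ → ℝ → ℝ} (hf : ∀ n, Continuous (f n))
    (hb : ∀ n r, |f n r| ≤ K * exp (-a * r)) {k : ℝ}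
    (hlim : ∀ n : ℕ, ∀ r : ℝ, r < n → f n r = k * exp (-a * r)) :
    Tendsto (fun n => ∫ r in Ioi R, r * f n r ^ 2) atTop
      (nhds (∫ r in Ioi R, k ^ 2 * (r * exp (-(2 * a) * r)))) := by
  have hexp : ∀ r, exp (-a * r) ^ 2 = exp (-(2 * a) * r) := fun r => by
    rw [← exp_nat_mul]; congr 1; push_cast; ring
  refine tendsto_integral_of_dominated_convergence
    (fun r => K ^ 2 * (r * exp (-(2 * a) * r))) (fun n => ?_)
    ((integral_Ioi_mul_exp (by positivity) hR).1.const_mul _) (fun n => ?_) ?_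
  · exact (continuous_id.mul ((hf n).pow 2)).aestronglyMeasurable
  · filter_upwards [ae_restrict_mem measurableSet_Ioi] with r hr
    have hr0 : 0 < r := hR.trans hr
    rw [norm_mul, norm_pow, Real.norm_of_nonneg hr0.le, Real.norm_eq_abs, ← hexp]
    calc r * |f n r| ^ 2 ≤ r * (K * exp (-a * r)) ^ 2 := by gcongr; exact hb n r
      _ = _ := by ring
  · refine Eventually.of_forall fun r => tendsto_const_nhds.congr' ?_
    obtain ⟨N, hN⟩ := exists_nat_gt r
    filter_upwards [eventually_ge_atTop N] with n hn
    rw [hlim n r (hN.trans_le (by exact_mod_cast hn)), mul_pow, hexp]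
    ring

lemma exists_robinQuotient_lt {a R : ℝ} (ha : 0 < a) (hR : 0 < R) (c : E2) :
    ∃ q ∈ robinQuotients (-a) (ball c R), q < -a ^ 2 + a / R := by
  obtain ⟨C, hC⟩ := exists_bound_deriv_smoothTransition
  have hd : Continuous (deriv smoothTransition) :=
    (smoothTransition.contDiff (n := 1)).continuous_deriv le_rfl
  have hs := smoothTransition.continuous
  have hs1 : ∀ x, |smoothTransition x| ≤ 1 := fun x => by
    rw [abs_of_nonneg (smoothTransition.nonneg x)]; exact smoothTransition.le_one x
  have hcut : ∀ n : ℕ, ∀ r : ℝ, r < n → cutExp a n r = exp (-a * r) := fun n r hr => by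
    rw [cutExp, smoothTransition.one_of_one_le (by linarith), mul_one]
  set E := exp (-(2 * a) * R) with hE
  set I := R / (2 * a) + 1 / (2 * a) ^ 2 with hI
  have hE0 : 0 < E := exp_pos _
  have hI0 : 0 < I := by positivity
  have hD : Tendsto (fun n => ∫ r in Ioi R, r * cutExp a n r ^ 2) atTop (nhds (E * I)) := by
    have := tendsto_integral_of_eventually_eq_exp (K := 1) (k := 1) ha hR (f := cutExp a)
      (fun n => by unfold cutExp; fun_prop) (fun n r => ?_) (fun n r hr => by simp [hcut n r hr])
    · rw [integral_const_mul, (integral_Ioi_mul_exp (b := 2 * a) (by positivity) hR).2] at this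
      rwa [one_pow, one_mul] at this
    · rw [cutExp, abs_mul, abs_of_pos (exp_pos _), mul_comm]
      gcongr
      exact hs1 _
  have hN : Tendsto (fun n => ∫ r in Ioi R, r * cutExpDeriv a n r ^ 2) atTop
      (nhds (a ^ 2 * (E * I))) := by
    have := tendsto_integral_of_eventually_eq_exp (K := a + C) (k := -a) ha hR (f := cutExpDeriv a)
      (fun n => by unfold cutExpDeriv; fun_prop) (fun n r => ?_) (fun n r hr => ?_)
    · rw [integral_const_mul, (integral_Ioi_mul_exp (b := 2 * a) (by positivity) hR).2] at this
      rwa [neg_sq] at this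
    · rw [cutExpDeriv, abs_mul, abs_of_pos (exp_pos _), mul_comm]
      gcongr
      refine (abs_sub _ _).trans (add_le_add ?_ (hC _))
      rw [abs_mul, abs_neg, abs_of_pos ha]
      exact mul_le_of_le_one_right ha.le (hs1 _)
    · have h1 : HasDerivAt (cutExp a n) (exp (-a * r) * (-a)) r := by
        have h0 : HasDerivAt (fun r => exp (-a * r)) (exp (-a * r) * (-a)) r := by
          simpa using ((hasDerivAt_id r).const_mul (-a)).exp
        refine h0.congr_of_eventuallyEq ?_
        filter_upwards [Iio_mem_nhds hr] with y hy using hcut n y hy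
      rw [(hasDerivAt_cutExp a n r).unique h1, mul_comm]
  have hq : Tendsto (fun n : ℕ => ((∫ r in Ioi R, r * cutExpDeriv a n r ^ 2) + -a * (R * E)) /
      ∫ r in Ioi R, r * cutExp a n r ^ 2) atTop
      (nhds ((a ^ 2 * (E * I) + -a * (R * E)) / (E * I))) :=
    (hN.add_const _).div hD (by positivity)
  have hlt : (a ^ 2 * (E * I) + -a * (R * E)) / (E * I) < -a ^ 2 + a / R := by
    have h1 : (a ^ 2 * (E * I) + -a * (R * E)) / (E * I) = a ^ 2 - a * R / I := by
      field_simp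
      ring
    have h2 : a * R / I = 4 * a ^ 3 * R / (2 * a * R + 1) := by
      rw [hI]
      field_simp
      ring
    rw [h1, h2, sub_lt_iff_lt_add, ← sub_pos]
    have h3 : -a ^ 2 + a / R + 4 * a ^ 3 * R / (2 * a * R + 1) - a ^ 2 =
        a / (R * (2 * a * R + 1)) := by
      field_simp
      ring
    rw [h3]
    positivity
  obtain ⟨n, hn, hRn⟩ := ((hq.eventually_lt_const hlt).and
    ((tendsto_natCast_atTop_atTop (R := ℝ)).eventually_gt_atTop R)).exists
  let w : ℝ → ℝ := fun r => smoothTransition (2 / R * r - 1) * cutExp a n r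
  have hwR : ∀ r, R ≤ r → w r = cutExp a n r := fun r hr => by
    have h1 : 1 ≤ 2 / R * r - 1 := by
      have : 2 / R * R ≤ 2 / R * r := by gcongr
      rw [div_mul_cancel₀ _ hR.ne'] at this
      linarith
    simp only [w]
    rw [smoothTransition.one_of_one_le h1, one_mul]
  have hw : ContDiff ℝ (⊤ : ℕ∞) w := by
    have hst : ContDiff ℝ (⊤ : ℕ∞) smoothTransition := smoothTransition.contDiff
    unfold w cutExp
    refine (hst.comp (by fun_prop)).mul (ContDiff.mul (by fun_prop) (hst.comp (by fun_prop)))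
  have hmem := radial_mem_robinQuotients (-a) c hR hw (ρ := R / 2) (by positivity)
    (fun r hr => ?_) (M := n + 1) (fun r hr => ?_) ⟨(R + n) / 2, by linarith, ?_⟩
  · refine ⟨_, hmem, ?_⟩
    have e1 : ∫ r in Ioi R, r * deriv w r ^ 2 = ∫ r in Ioi R, r * cutExpDeriv a n r ^ 2 := by
      refine setIntegral_congr_fun measurableSet_Ioi fun r hr => ?_
      have : deriv w r = cutExpDeriv a n r := by
        rw [← (hasDerivAt_cutExp a n r).deriv]
        refine Filter.EventuallyEq.deriv_eq ?_
        filter_upwards [Ioi_mem_nhds hr] with y hy using hwR y (le_of_lt hy)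
      simp only [this]
    have e2 : ∫ r in Ioi R, r * w r ^ 2 = ∫ r in Ioi R, r * cutExp a n r ^ 2 := by
      refine setIntegral_congr_fun measurableSet_Ioi fun r hr => ?_
      simp only [hwR r (le_of_lt hr)]
    have e3 : w R ^ 2 = E := by
      rw [hwR R le_rfl, hcut n R hRn, ← exp_nat_mul, hE]
      congr 1
      push_cast
      ring
    rw [e1, e2, e3]
    exact hn
  · have : 2 / R * r ≤ 2 / R * (R / 2) := by gcongr
    simp only [w]
    rw [smoothTransition.zero_of_nonpos, zero_mul]
    field_simp at this ⊢
    linarith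
  · simp only [w, cutExp]
    rw [smoothTransition.zero_of_nonpos (x := n + 1 - r) (by linarith), mul_zero, mul_zero]
  · rw [hwR _ (by linarith), hcut n _ (by linarith)]
    exact (exp_pos _).ne'

lemma le_of_mem_robinQuotients {a R : ℝ} (ha : 0 < a) (hR : 0 < R) (c : E2) {q : ℝ}
    (hq : q ∈ robinQuotients (-a) (ball c R)) : -a ^ 2 + robinGap a R ≤ q := by
  obtain ⟨u, hu, hc, ⟨x, hx, hux⟩, rfl⟩ := hq
  have hopen : IsOpen (extDom (ball c R)) := isClosed_closure.isOpen_compl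
  have hpos : 0 < ∫ x in extDom (ball c R), u x ^ 2 := by
    have hInt : Integrable fun x => u x ^ 2 :=
      (hu.continuous.pow 2).integrable_of_hasCompactSupport (by
        simpa [sq] using hc.mul_left (f := u))
    rw [setIntegral_pos_iff_support_of_nonneg_ae (Eventually.of_forall fun x => sq_nonneg (u x))
      hInt.integrableOn]
    refine IsOpen.measure_pos _ (IsOpen.inter ?_ hopen) ⟨x, by simpa using hux, hx⟩
    exact (hu.continuous.pow 2).isOpen_support
  rw [le_div_iff₀ hpos, frontier_ball c hR.ne']
  linarith [robin_form_lower ha hR c hu hc]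

/-- Bounds on the lowest Robin eigenvalue of the exterior of a disk. -/
theorem robinEig_ball_bounds
    (α : ℝ) (hα : α < 0) (R : ℝ) (hR : 0 < R) (c : E2) :
    -α ^ 2 < robinEig α (ball c R) ∧ robinEig α (ball c R) < -α ^ 2 - α / R := by
  obtain ⟨a, rfl⟩ : ∃ a, α = -a := ⟨-α, (neg_neg α).symm⟩
  have ha : 0 < a := neg_lt_zero.1 hα
  change -(-a) ^ 2 < sInf (robinQuotients (-a) (ball c R)) ∧
    sInf (robinQuotients (-a) (ball c R)) < -(-a) ^ 2 - -a / R
  rw [neg_sq, neg_div, sub_neg_eq_add]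
  obtain ⟨q, hq, hlt⟩ := exists_robinQuotient_lt ha hR c
  refine ⟨?_, (csInf_le ⟨_, fun q hq => le_of_mem_robinQuotients ha hR c hq⟩ hq).trans_lt hlt⟩
  have hgap : 0 < robinGap a R := lt_min (by positivity) (by positivity)
  exact (lt_add_of_pos_right _ hgap).trans_le
    (le_csInf ⟨q, hq⟩ fun q hq => le_of_mem_robinQuotients ha hR c hq)

end
end
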